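/- arXiv:2110.15656 — 6 statements merged into one kernel-verified Lean document; each statement's English description precedes it below -/
import Mathlib

section
/- Let 0 < a < b, let n be a positive integer, let α ∈ (n−1, n), let f : [a,b] → ℝ be continuous, and let g : [a,b] → ℝ be n times continuously differentiable with (D_H^k g)(a) = 0 and (D_H^k g)(b) = 0 for all k = 0, …, n−1. Assume both functions x ↦ ∫_a^x (ln(x/t))^{n−α−1} f(t) t⁻¹ dt and x ↦ ∫_x^b (ln(t/x))^{n−α−1} f(t) t⁻¹ dt are n times continuously D_H-differentiable on [a,b], and that the Riesz Hadamard fractional derivative ^{RH}D^α_{[a,b]} g(x) exists for x ∈ (a,b). Then ∫_a^b x⁻¹ f(x) · ^{RH}D^α_{[a,b]} g(x) dx = (−1)^n ∫_a^b x⁻¹ · (^{RH}D^α_{[a,b]} f(x)) · g(x) dx. -/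
open MeasureTheory

/-- The Hadamard differential operator `D_H g = x ↦ x * g'(x)`. -/
noncomputable def DH (g : ℝ → ℝ) : ℝ → ℝ := fun x => x * deriv g x

/-- The kernel integral appearing in the left Hadamard fractional derivative:
`y ↦ ∫_a^y (ln(y/t))^(n-α-1) f(t) t⁻¹ dt`. -/
noncomputable def hadLeftKer (a α : ℝ) (n : ℕ) (f : ℝ → ℝ) : ℝ → ℝ :=
  fun y => ∫ t in a..y, Real.log (y / t) ^ ((n : ℝ) - α - 1) * f t / t

/-- The kernel integral appearing in the right Hadamard fractional derivative:
`y ↦ ∫_y^b (ln(t/y))^(n-α-1) f(t) t⁻¹ dt`. -/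
noncomputable def hadRightKer (b α : ℝ) (n : ℕ) (f : ℝ → ℝ) : ℝ → ℝ :=
  fun y => ∫ t in y..b, Real.log (t / y) ^ ((n : ℝ) - α - 1) * f t / t

/-- The left Hadamard fractional derivative `^H D^α_{[a,x]} f (x)`. -/
noncomputable def hadLeft (a α : ℝ) (n : ℕ) (f : ℝ → ℝ) (x : ℝ) : ℝ :=
  (1 / Real.Gamma ((n : ℝ) - α)) * DH^[n] (hadLeftKer a α n f) x

/-- The right Hadamard fractional derivative `^H D^α_{[x,b]} f (x)`. -/
noncomputable def hadRight (b α : ℝ) (n : ℕ) (f : ℝ → ℝ) (x : ℝ) : ℝ :=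
  (1 / Real.Gamma ((n : ℝ) - α)) * ((-1 : ℝ) ^ n * DH^[n] (hadRightKer b α n f) x)

/-- The left Hadamard–Caputo fractional derivative `^C D^α_{[a,x]} f (x)`. -/
noncomputable def capLeft (a α : ℝ) (n : ℕ) (f : ℝ → ℝ) (x : ℝ) : ℝ :=
  (1 / Real.Gamma ((n : ℝ) - α)) *
    ∫ t in a..x, Real.log (x / t) ^ ((n : ℝ) - α - 1) * DH^[n] f t / t

/-- The right Hadamard–Caputo fractional derivative `^C D^α_{[x,b]} f (x)`. -/
noncomputable def capRight (b α : ℝ) (n : ℕ) (f : ℝ → ℝ) (x : ℝ) : ℝ :=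
  (1 / Real.Gamma ((n : ℝ) - α)) *
    ∫ t in x..b, Real.log (t / x) ^ ((n : ℝ) - α - 1) * ((-1 : ℝ) ^ n * DH^[n] f t) / t

/-- The Riesz Hadamard fractional derivative `^{RH} D^α_{[a,b]} f (x)`. -/
noncomputable def rieszHad (a b α : ℝ) (n : ℕ) (f : ℝ → ℝ) (x : ℝ) : ℝ :=
  (1 / 2) * (hadLeft a α n f x + (-1 : ℝ) ^ n * hadRight b α n f x)

/-- The Riesz–Caputo fractional derivative `^{RC} D^α_{[a,b]} f (x)`. -/
noncomputable def rieszCap (a b α : ℝ) (n : ℕ) (f : ℝ → ℝ) (x : ℝ) : ℝ :=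
  (1 / 2) * (capLeft a α n f x + (-1 : ℝ) ^ n * capRight b α n f x)

/-- The order-(α−n+k) left Hadamard fractional derivative `^H D^{α-n+k}_{[a,x]} f (x)`. -/
noncomputable def hadLeftLow (a α : ℝ) (n k : ℕ) (f : ℝ → ℝ) (x : ℝ) : ℝ :=
  (1 / Real.Gamma ((n : ℝ) - α)) * DH^[k] (hadLeftKer a α n f) x

/-- The order-(α−n+k) right Hadamard fractional derivative `^H D^{α-n+k}_{[x,b]} f (x)`. -/
noncomputable def hadRightLow (b α : ℝ) (n k : ℕ) (f : ℝ → ℝ) (x : ℝ) : ℝ :=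
  (1 / Real.Gamma ((n : ℝ) - α)) * ((-1 : ℝ) ^ k * DH^[k] (hadRightKer b α n f) x)

/-- The order-(α−n+k) Riesz Hadamard fractional derivative `^{RH} D^{α-n+k}_{[a,b]} f (x)`. -/
noncomputable def rieszHadLow (a b α : ℝ) (n k : ℕ) (f : ℝ → ℝ) (x : ℝ) : ℝ :=
  (1 / 2) * (hadLeftLow a α n k f x + (-1 : ℝ) ^ k * hadRightLow b α n k f x)

/-- `F` is `n` times continuously `D_H`-differentiable on `s`. -/
def ContDHDiffOn (n : ℕ) (F : ℝ → ℝ) (s : Set ℝ) : Prop :=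
  (∀ k ≤ n, ContinuousOn (DH^[k] F) s) ∧
    ∀ k < n, ∀ x ∈ s, DifferentiableAt ℝ (DH^[k] F) x

namespace RH
noncomputable def RI (s : ℝ) (u : ℝ → ℝ) (x : ℝ) : ℝ :=
  ∫ t in (0:ℝ)..x, (x - t) ^ (s - 1) * u t

noncomputable def RJ (L s : ℝ) (u : ℝ → ℝ) (x : ℝ) : ℝ :=
  ∫ t in x..L, (t - x) ^ (s - 1) * u t

lemma RJ_eq (L s : ℝ) (u : ℝ → ℝ) (x : ℝ) :
    RJ L s u x = RI s (fun t => u (L - t)) (L - x) := by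
  unfold RJ RI
  have := intervalIntegral.integral_comp_sub_left (a := 0) (b := L - x)
    (fun t => (t - x) ^ (s - 1) * u t) L
  simp only [sub_sub_cancel, sub_zero] at this
  rw [← this]
  congr 1
  ext t
  rw [show L - t - x = L - x - t by ring]

lemma exists_ext {L : ℝ} (hL : 0 < L) {u : ℝ → ℝ} (hu : ContinuousOn u (Set.Icc 0 L)) :
    ∃ (v : ℝ → ℝ) (M : ℝ), Continuous v ∧ (∀ r, |v r| ≤ M) ∧ 0 ≤ M ∧ Set.EqOn u v (Set.Icc 0 L) := by
  obtain ⟨M, hM⟩ := isCompact_Icc.exists_bound_of_continuousOn hu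
  refine ⟨Set.IccExtend hL.le ((Set.Icc 0 L).domRestrict u), M, ?_, ?_, ?_, ?_⟩
  · exact (continuousOn_iff_continuous_domRestrict.mp hu).Icc_extend'
  · intro r
    simp only [Set.IccExtend, Function.comp]
    exact hM _ (Set.projIcc 0 L hL.le r).2
  · exact (norm_nonneg _).trans (hM 0 ⟨le_rfl, hL.le⟩)
  · intro x hx
    rw [Set.IccExtend_of_mem _ _ hx]; rfl

lemma RI_congr {s L : ℝ} {u v : ℝ → ℝ} (h : Set.EqOn u v (Set.Icc 0 L)) {x : ℝ}
    (hx : x ∈ Set.Icc 0 L) : RI s u x = RI s v x := by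
  unfold RI
  apply intervalIntegral.integral_congr
  intro t ht
  rw [Set.uIcc_of_le hx.1] at ht
  simp only
  rw [h ⟨ht.1, ht.2.trans hx.2⟩]

lemma ker_int {s : ℝ} (hs : 0 < s) (c x d : ℝ) :
    IntervalIntegrable (fun t => (x - t) ^ (s - 1)) volume c d := by
  have := (intervalIntegral.intervalIntegrable_rpow' (a := x - c) (b := x - d)
    (show -1 < s - 1 by linarith)).comp_sub_left x
  simpa using this

lemma ker_int' {s : ℝ} (hs : 0 < s) (c x d : ℝ) :
    IntervalIntegrable (fun t => (t - x) ^ (s - 1)) volume c d := by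
  have := (intervalIntegral.intervalIntegrable_rpow' (a := c - x) (b := d - x)
    (show -1 < s - 1 by linarith)).comp_sub_right x
  simpa using this

lemma ker_val {s : ℝ} (hs : 0 < s) (x : ℝ) :
    ∫ t in (0:ℝ)..x, (x - t) ^ (s - 1) = x ^ s / s := by
  rw [intervalIntegral.integral_comp_sub_left (fun y => y ^ (s - 1)) x]
  rw [integral_rpow (Or.inl (by linarith))]
  simp [Real.zero_rpow hs.ne']

lemma ker_val' {s : ℝ} (hs : 0 < s) (r x : ℝ) :
    ∫ t in r..x, (t - r) ^ (s - 1) = (x - r) ^ s / s := by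
  rw [intervalIntegral.integral_comp_sub_right (fun y => y ^ (s - 1)) r]
  rw [integral_rpow (Or.inl (by linarith))]
  simp [Real.zero_rpow hs.ne']

/-- Scaled form, for continuity. -/
lemma RI_scaled {s : ℝ} (hs : 0 < s) (u : ℝ → ℝ) {x : ℝ} (hx : 0 ≤ x) :
    RI s u x = x ^ s * ∫ t in (0:ℝ)..1, (1 - t) ^ (s - 1) * u (x * t) := by
  rcases hx.eq_or_lt with rfl | hx
  · simp [RI, Real.zero_rpow hs.ne']
  unfold RI
  have := intervalIntegral.integral_comp_mul_left (a := 0) (b := 1)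
    (fun t => (x - t) ^ (s - 1) * u t) hx.ne'
  simp only [mul_zero, mul_one, smul_eq_mul] at this
  have h2 : ∫ t in (0:ℝ)..x, (x - t) ^ (s - 1) * u t
      = x * ∫ t in (0:ℝ)..1, (x - x * t) ^ (s - 1) * u (x * t) := by
    rw [this]; field_simp
  rw [h2, show x ^ s = x * x ^ (s - 1) by
    rw [Real.rpow_sub_one hx.ne']; field_simp, mul_assoc]
  congr 1
  rw [← intervalIntegral.integral_const_mul]
  apply intervalIntegral.integral_congr
  intro t ht
  rw [Set.uIcc_of_le zero_le_one] at ht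
  simp only
  rw [show x - x * t = x * (1 - t) by ring, Real.mul_rpow hx.le (by linarith [ht.2])]
  ring

lemma RI_cont' {s : ℝ} (hs : 0 < s) {v : ℝ → ℝ} {M : ℝ} (hv : Continuous v) (hM : ∀ r, |v r| ≤ M) :
    ContinuousOn (RI s v) (Set.Ici 0) := by
  have h1 : Continuous (fun x => ∫ t in (0:ℝ)..1, (1 - t) ^ (s - 1) * v (x * t)) := by
    apply intervalIntegral.continuous_of_dominated_interval
      (bound := fun t => |(1 - t) ^ (s - 1)| * M)
    · intro x
      apply AEStronglyMeasurable.mul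
      · exact (ker_int hs 0 1 1).def'.aestronglyMeasurable
      · exact (hv.comp (continuous_const.mul continuous_id)).aestronglyMeasurable
    · intro x
      refine Filter.Eventually.of_forall fun t _ => ?_
      rw [Real.norm_eq_abs, abs_mul]
      exact mul_le_mul_of_nonneg_left (hM _) (abs_nonneg _)
    · exact (ker_int hs 0 1 1).abs.mul_const M
    · refine Filter.Eventually.of_forall fun t _ => ?_
      fun_prop
  have h2 : ContinuousOn (fun x : ℝ => x ^ s * ∫ t in (0:ℝ)..1, (1 - t) ^ (s - 1) * v (x * t))
      (Set.Ici 0) :=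
    ((Real.continuous_rpow_const hs.le).mul h1).continuousOn
  exact h2.congr fun x hx => RI_scaled hs v hx

lemma RI_cont {s L : ℝ} (hs : 0 < s) (hL : 0 < L) {u : ℝ → ℝ} (hu : ContinuousOn u (Set.Icc 0 L)) :
    ContinuousOn (RI s u) (Set.Icc 0 L) := by
  obtain ⟨v, M, hv, hM, -, he⟩ := exists_ext hL hu
  exact ((RI_cont' hs hv hM).mono Set.Icc_subset_Ici_self).congr fun x hx => RI_congr he hx

lemma RI_int {s L : ℝ} (hs : 0 < s) {u : ℝ → ℝ} (hu : ContinuousOn u (Set.Icc 0 L))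
    {x : ℝ} (hx : x ∈ Set.Icc 0 L) :
    IntervalIntegrable (fun t => (x - t) ^ (s - 1) * u t) volume 0 x := by
  apply (ker_int hs 0 x x).mul_continuousOn
  rw [Set.uIcc_of_le hx.1]
  exact hu.mono (Set.Icc_subset_Icc_right hx.2)

lemma RI_mono {s L : ℝ} (hs : 0 < s) {u v : ℝ → ℝ} (hu : ContinuousOn u (Set.Icc 0 L))
    (hv : ContinuousOn v (Set.Icc 0 L)) {x : ℝ} (hx : x ∈ Set.Icc 0 L)
    (h : ∀ t ∈ Set.Icc 0 x, u t ≤ v t) : RI s u x ≤ RI s v x := by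
  apply intervalIntegral.integral_mono_on hx.1 (RI_int hs hu hx) (RI_int hs hv hx)
  intro t ht
  exact mul_le_mul_of_nonneg_left (h t ht) (Real.rpow_nonneg (by linarith [ht.2]) _)

lemma RI_const {s : ℝ} (hs : 0 < s) (c x : ℝ) : RI s (fun _ => c) x = c * (x ^ s / s) := by
  unfold RI
  rw [intervalIntegral.integral_mul_const, ker_val hs, mul_comm]

lemma RI_bound {s L : ℝ} (hs : 0 < s) {u : ℝ → ℝ} (hu : ContinuousOn u (Set.Icc 0 L))
    {x M : ℝ} (hx : x ∈ Set.Icc 0 L)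
    (h : ∀ t ∈ Set.Icc 0 L, |u t| ≤ M) : |RI s u x| ≤ M * (x ^ s / s) := by
  rw [abs_le]
  constructor
  · rw [← neg_mul, ← RI_const hs]
    exact RI_mono hs continuousOn_const hu hx
      fun t ht => (abs_le.mp (h t ⟨ht.1, ht.2.trans hx.2⟩)).1
  · rw [← RI_const hs]
    exact RI_mono hs hu continuousOn_const hx
      fun t ht => (abs_le.mp (h t ⟨ht.1, ht.2.trans hx.2⟩)).2

lemma RI_zero (s : ℝ) (u : ℝ → ℝ) : RI s u 0 = 0 := by simp [RI]

lemma RI_const_mul (s c : ℝ) (u : ℝ → ℝ) (x : ℝ) :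
    RI s (fun t => c * u t) x = c * RI s u x := by
  unfold RI
  rw [← intervalIntegral.integral_const_mul]
  congr 1; ext t; ring

lemma fubini {b X M : ℝ} (hb : 0 < b) (hX : 0 ≤ X) {h v : ℝ → ℝ}
    (hh : IntervalIntegrable h volume 0 X) (hv : Continuous v) (hM : ∀ r, |v r| ≤ M) :
    ∫ t in (0:ℝ)..X, h t * RI b v t
      = ∫ r in (0:ℝ)..X, v r * ∫ t in r..X, h t * (t - r) ^ (b - 1) := by
  set k : ℝ → ℝ := (Set.Ioc 0 X).indicator (fun y => y ^ (b - 1)) with hk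
  set h' : ℝ → ℝ := (Set.Ioc 0 X).indicator h with hh'
  have hkI : Integrable k := by
    rw [hk, integrable_indicator_iff measurableSet_Ioc,
      ← intervalIntegrable_iff_integrableOn_Ioc_of_le hX]
    exact intervalIntegral.intervalIntegrable_rpow' (by linarith)
  have hhI : Integrable h' := by
    rw [hh', integrable_indicator_iff measurableSet_Ioc,
      ← intervalIntegrable_iff_integrableOn_Ioc_of_le hX]
    exact hh
  have hconv : Integrable (fun p : ℝ × ℝ => h' p.2 * k (p.2 - p.1)) (volume.prod volume) := by
    have := Integrable.convolution_integrand (ContinuousLinearMap.mul ℝ ℝ) hhI hkI.comp_neg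
      (μ := volume) (ν := volume)
    simpa using this
  set v' : ℝ → ℝ := (Set.Ioc 0 X).indicator v with hv'
  have hv'm : Measurable v' := hv.measurable.indicator measurableSet_Ioc
  have hv'b : ∀ r, |v' r| ≤ M := by
    intro r
    by_cases hr : r ∈ Set.Ioc 0 X
    · rw [hv', Set.indicator_of_mem hr]; exact hM r
    · rw [hv', Set.indicator_of_notMem hr, abs_zero]; exact (abs_nonneg _).trans (hM r)
  have hconv2 : Integrable (fun p : ℝ × ℝ => v' p.1 * (h' p.2 * k (p.2 - p.1)))
      (volume.prod volume) := by
    refine hconv.bdd_mul (c := M) ?_ ?_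
    · exact (hv'm.comp measurable_fst).aestronglyMeasurable
    · exact Filter.Eventually.of_forall fun p => hv'b _
  have key := integral_integral_swap (f := fun r t => v' r * (h' t * k (t - r))) hconv2
  have e1 : ∀ r, ∫ t, v' r * (h' t * k (t - r)) =
      (Set.Ioc 0 X).indicator (fun r => v r * ∫ t in r..X, h t * (t - r) ^ (b - 1)) r := by
    intro r
    by_cases hr : r ∈ Set.Ioc 0 X
    · rw [Set.indicator_of_mem hr, hv', Set.indicator_of_mem hr, integral_const_mul,
        intervalIntegral.integral_of_le hr.2, ← integral_indicator measurableSet_Ioc]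
      congr 2
      ext t
      simp only [hh', hk, Set.indicator, Set.mem_Ioc]
      have := hr.1
      have := hr.2
      by_cases h1 : r < t ∧ t ≤ X
      · rw [if_pos h1, if_pos ⟨by linarith, h1.2⟩, if_pos ⟨by linarith, by linarith⟩]
      · rw [if_neg h1]
        by_cases h2 : 0 < t ∧ t ≤ X
        · rw [if_pos h2, if_neg, mul_zero]
          rintro ⟨h3, h4⟩
          exact h1 ⟨by linarith, h2.2⟩
        · rw [if_neg h2, zero_mul]
    · rw [Set.indicator_of_notMem hr, hv', Set.indicator_of_notMem hr]
      simp
  have e2 : ∀ t, ∫ r, v' r * (h' t * k (t - r)) =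
      (Set.Ioc 0 X).indicator (fun t => h t * RI b v t) t := by
    intro t
    by_cases ht : t ∈ Set.Ioc 0 X
    · rw [Set.indicator_of_mem ht, hh', Set.indicator_of_mem ht]
      unfold RI
      rw [intervalIntegral.integral_of_le ht.1.le, integral_Ioc_eq_integral_Ioo,
        ← integral_indicator measurableSet_Ioo, ← integral_const_mul]
      congr 1
      ext r
      simp only [hv', hk, Set.indicator, Set.mem_Ioc, Set.mem_Ioo]
      have := ht.1
      have := ht.2
      by_cases h1 : 0 < r ∧ r < t
      · rw [if_pos h1, if_pos ⟨h1.1, by linarith⟩, if_pos ⟨by linarith, by linarith⟩]; ring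
      · rw [if_neg h1]
        by_cases h2 : 0 < r ∧ r ≤ X
        · rw [if_pos h2, if_neg, mul_zero, mul_zero]
          rintro ⟨h3, h4⟩
          exact h1 ⟨h2.1, by linarith⟩
        · rw [if_neg h2, zero_mul, mul_zero]
    · rw [Set.indicator_of_notMem ht, hh', Set.indicator_of_notMem ht]
      simp
  simp_rw [e1, e2] at key
  rw [integral_indicator measurableSet_Ioc, integral_indicator measurableSet_Ioc] at key
  rw [intervalIntegral.integral_of_le hX, intervalIntegral.integral_of_le hX, key]

/-- Fractional integration by parts. -/
lemma duality {s L : ℝ} (hs : 0 < s) (hL : 0 < L) {f g : ℝ → ℝ} (hf : ContinuousOn f (Set.Icc 0 L))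
    (hg : ContinuousOn g (Set.Icc 0 L)) :
    ∫ t in (0:ℝ)..L, f t * RI s g t = ∫ t in (0:ℝ)..L, RJ L s f t * g t := by
  obtain ⟨v, M, hv, hM, -, he⟩ := exists_ext hL hg
  have h1 : ∫ t in (0:ℝ)..L, f t * RI s g t = ∫ t in (0:ℝ)..L, f t * RI s v t := by
    apply intervalIntegral.integral_congr
    intro t ht
    rw [Set.uIcc_of_le hL.le] at ht
    simp only
    rw [RI_congr he ht]
  rw [h1, fubini hs hL.le (hf.intervalIntegrable_of_Icc hL.le) hv hM]
  apply intervalIntegral.integral_congr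
  intro t ht
  rw [Set.uIcc_of_le hL.le] at ht
  simp only
  rw [he ht, mul_comm, RJ]
  congr 2
  ext r
  ring

/-- Weighted Beta integral. -/
lemma beta_scaled {a b : ℝ} {r x : ℝ} (hr : r < x) :
    ∫ t in r..x, (x - t) ^ (a - 1) * (t - r) ^ (b - 1)
      = (x - r) ^ (a + b - 1) * ∫ t in (0:ℝ)..1, (1 - t) ^ (a - 1) * t ^ (b - 1) := by
  have hx : 0 < x - r := by linarith
  have := intervalIntegral.integral_comp_mul_add (a := 0) (b := 1)
    (fun t => (x - t) ^ (a - 1) * (t - r) ^ (b - 1)) hx.ne' r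
  simp only [mul_zero, mul_one, smul_eq_mul, zero_add, sub_add_cancel] at this
  have h2 : ∫ t in r..x, (x - t) ^ (a - 1) * (t - r) ^ (b - 1)
      = (x - r) * ∫ t in (0:ℝ)..1, (x - ((x - r) * t + r)) ^ (a - 1) *
        ((x - r) * t + r - r) ^ (b - 1) := by
    rw [this]; field_simp
  rw [h2, show (x - r) ^ (a + b - 1) = (x - r) * ((x - r) ^ (a - 1) * (x - r) ^ (b - 1)) by
    rw [← Real.rpow_add hx, mul_comm, ← Real.rpow_add_one hx.ne']
    congr 1; ring, mul_assoc]
  congr 1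
  rw [← intervalIntegral.integral_const_mul]
  apply intervalIntegral.integral_congr
  intro t ht
  rw [Set.uIcc_of_le zero_le_one] at ht
  simp only
  rw [show x - ((x - r) * t + r) = (x - r) * (1 - t) by ring,
    show (x - r) * t + r - r = (x - r) * t by ring, Real.mul_rpow hx.le (by linarith [ht.2]),
    Real.mul_rpow hx.le ht.1]
  ring

lemma semigroup {a b L : ℝ} (ha : 0 < a) (hb : 0 < b) (hL : 0 < L) {u : ℝ → ℝ}
    (hu : ContinuousOn u (Set.Icc 0 L)) {x : ℝ} (hx : x ∈ Set.Icc 0 L) :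
    RI a (RI b u) x = (∫ t in (0:ℝ)..1, (1 - t) ^ (a - 1) * t ^ (b - 1)) * RI (a + b) u x := by
  obtain ⟨v, M, hv, hM, -, he⟩ := exists_ext hL hu
  rw [RI_congr (fun t ht => RI_congr he ht) hx, RI_congr he hx, RI,
    fubini hb hx.1 (ker_int ha 0 x x) hv hM, RI, ← intervalIntegral.integral_const_mul]
  apply intervalIntegral.integral_congr_ae
  have : ∀ᵐ t : ℝ, t ≠ x := by simp [ae_iff, measure_singleton]
  filter_upwards [this] with r hr hr2
  rw [Set.uIoc_of_le hx.1] at hr2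
  rw [beta_scaled (lt_of_le_of_ne hr2.2 hr)]
  ring

lemma beta_pos {a b : ℝ} (ha : 0 < a) (hb : 0 < b) :
    0 < ∫ t in (0:ℝ)..1, (1 - t) ^ (a - 1) * t ^ (b - 1) := by
  have h1 : (1:ℝ) ∈ Set.Icc (0:ℝ) 1 := ⟨zero_le_one, le_rfl⟩
  have h := semigroup ha hb one_pos (u := fun _ => 1) continuousOn_const h1
  rw [RI_const (by linarith)] at h
  have h2 : 0 < RI a (RI b fun _ => 1) 1 := by
    apply intervalIntegral.intervalIntegral_pos_of_pos_on
      (RI_int ha (RI_cont hb one_pos continuousOn_const) h1) _ one_pos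
    intro t ht
    rw [RI_const hb]
    have := ht.1
    have := ht.2
    have h3 : 0 < 1 - t := by linarith
    positivity
  rw [h] at h2
  have h3 : 0 < 1 * ((1:ℝ) ^ (a + b) / (a + b)) := by
    have : 0 < a + b := by linarith
    positivity
  exact pos_of_mul_pos_left h2 h3.le

lemma beta_one (a : ℝ) (ha : 0 < a) :
    ∫ t in (0:ℝ)..1, (1 - t) ^ (a - 1) * t ^ ((1:ℝ) - 1) = 1 / a := by
  have := ker_val ha 1
  simpa using this

lemma one_beta (a : ℝ) (ha : 0 < a) :
    ∫ t in (0:ℝ)..1, (1 - t) ^ ((1:ℝ) - 1) * t ^ (a - 1) = 1 / a := by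
  have := ker_val' ha 0 1
  simpa using this

lemma RI_one (u : ℝ → ℝ) (x : ℝ) : RI 1 u x = ∫ t in (0:ℝ)..x, u t := by simp [RI]

lemma ftc {L : ℝ} {u u' : ℝ → ℝ} (hu : ContinuousOn u (Set.Icc 0 L))
    (hu' : ContinuousOn u' (Set.Icc 0 L)) (hd : ∀ x ∈ Set.Ioo 0 L, HasDerivAt u (u' x) x)
    {x : ℝ} (hx : x ∈ Set.Icc 0 L) : u x = u 0 + ∫ t in (0:ℝ)..x, u' t := by
  have hs : Set.Icc 0 x ⊆ Set.Icc 0 L := Set.Icc_subset_Icc_right hx.2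
  rw [intervalIntegral.integral_eq_sub_of_hasDerivAt_of_le hx.1 (hu.mono hs)
    (fun y hy => hd y ⟨hy.1, hy.2.trans_le hx.2⟩) ((hu'.mono hs).intervalIntegrable_of_Icc hx.1)]
  ring

lemma int_deriv {L : ℝ} {u : ℝ → ℝ} (hu : ContinuousOn u (Set.Icc 0 L)) {x : ℝ}
    (hx : x ∈ Set.Ioo 0 L) : HasDerivAt (fun x => ∫ t in (0:ℝ)..x, u t) (u x) x := by
  apply intervalIntegral.integral_hasDerivAt_right
  · exact (hu.mono (Set.Icc_subset_Icc_right hx.2.le)).intervalIntegrable_of_Icc hx.1.le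
  · exact hu.stronglyMeasurableAtFilter_nhdsWithin measurableSet_Icc x |>.filter_mono
      (by rw [nhdsWithin_eq_nhds.mpr (Icc_mem_nhds hx.1 hx.2)])
  · exact hu.continuousAt (Icc_mem_nhds hx.1 hx.2)

/-- Key lemma: derivative of the fractional integral. -/
lemma RI_deriv {s L : ℝ} (hs : 0 < s) (hL : 0 < L) {u u' : ℝ → ℝ}
    (hu : ContinuousOn u (Set.Icc 0 L))
    (hu' : ContinuousOn u' (Set.Icc 0 L)) (hd : ∀ x ∈ Set.Ioo 0 L, HasDerivAt u (u' x) x)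
    {x : ℝ} (hx : x ∈ Set.Ioo 0 L) :
    HasDerivAt (RI s u) (u 0 * x ^ (s - 1) + RI s u' x) x := by
  have h1 : ∀ y ∈ Set.Icc 0 L, RI s u y = u 0 * (y ^ s / s) + ∫ t in (0:ℝ)..y, RI s u' t := by
    intro y hy
    have e1 : Set.EqOn u (fun z => u 0 + RI 1 u' z) (Set.Icc 0 L) := by
      intro z hz
      simp only [RI_one]
      exact ftc hu hu' hd hz
    have c1 := RI_cont one_pos hL hu'
    rw [RI_congr e1 hy]
    have : RI s (fun z => u 0 + RI 1 u' z) y = RI s (fun _ => u 0) y + RI s (RI 1 u') y := by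
      unfold RI
      rw [← intervalIntegral.integral_add]
      · congr 1; ext t; ring
      · exact RI_int hs continuousOn_const hy
      · exact RI_int hs c1 hy
    rw [this, RI_const hs, semigroup hs one_pos hL hu' hy, ← RI_one (RI s u') y,
      semigroup one_pos hs hL hu' hy, beta_one s hs, one_beta s hs, add_comm s 1]
  have h2 : HasDerivAt (fun y => u 0 * (y ^ s / s) + ∫ t in (0:ℝ)..y, RI s u' t)
      (u 0 * x ^ (s - 1) + RI s u' x) x := by
    apply HasDerivAt.add _ (int_deriv (RI_cont hs hL hu') hx)
    have := ((Real.hasDerivAt_rpow_const (x := x) (p := s) (Or.inl hx.1.ne')).div_const s).const_mul (u 0)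
    rw [mul_div_cancel_left₀ _ hs.ne'] at this
    exact this
  refine h2.congr_of_eventuallyEq ?_
  filter_upwards [Icc_mem_nhds hx.1 hx.2] with y hy using h1 y hy

lemma eqOn_Icc {L : ℝ} (hL : 0 < L) {u v : ℝ → ℝ} (hu : ContinuousOn u (Set.Icc 0 L))
    (hv : ContinuousOn v (Set.Icc 0 L)) (h : ∀ x ∈ Set.Ioo 0 L, u x = v x) :
    Set.EqOn u v (Set.Icc 0 L) := by
  have h' : Set.EqOn u v (Set.Ioo 0 L) := h
  exact h'.of_subset_closure hu hv Set.Ioo_subset_Icc_self (closure_Ioo hL.ne).ge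

lemma refl_cont {L : ℝ} {u : ℝ → ℝ} (hu : ContinuousOn u (Set.Icc 0 L)) :
    ContinuousOn (fun t => u (L - t)) (Set.Icc 0 L) :=
  hu.comp (continuous_const.sub continuous_id).continuousOn
    fun t ht => ⟨by simpa using ht.2, by simpa using ht.1⟩

lemma refl_deriv {L : ℝ} {u u' : ℝ → ℝ} (hd : ∀ x ∈ Set.Ioo 0 L, HasDerivAt u (u' x) x) :
    ∀ x ∈ Set.Ioo 0 L, HasDerivAt (fun t => u (L - t)) (-u' (L - x)) x := by
  intro x hx
  have := (hd (L - x) ⟨by linarith [hx.2], by linarith [hx.1]⟩).comp_const_sub L x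
  exact this

lemma RJ_cont {s L : ℝ} (hs : 0 < s) (hL : 0 < L) {u : ℝ → ℝ} (hu : ContinuousOn u (Set.Icc 0 L)) :
    ContinuousOn (RJ L s u) (Set.Icc 0 L) :=
  (refl_cont (RI_cont hs hL (refl_cont hu))).congr fun x _ => RJ_eq L s u x

lemma RI_neg (s : ℝ) (u : ℝ → ℝ) (x : ℝ) : RI s (fun t => - u t) x = - RI s u x := by
  simp [RI]

lemma RJ_neg (L s : ℝ) (u : ℝ → ℝ) (x : ℝ) : RJ L s (fun t => - u t) x = - RJ L s u x := by
  simp [RJ]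

lemma RJ_deriv {s L : ℝ} (hs : 0 < s) (hL : 0 < L) {u u' : ℝ → ℝ}
    (hu : ContinuousOn u (Set.Icc 0 L)) (h0 : u L = 0)
    (hu' : ContinuousOn u' (Set.Icc 0 L)) (hd : ∀ x ∈ Set.Ioo 0 L, HasDerivAt u (u' x) x)
    {x : ℝ} (hx : x ∈ Set.Ioo 0 L) :
    HasDerivAt (RJ L s u) (RJ L s u' x) x := by
  have e : RJ L s u = fun y => RI s (fun t => u (L - t)) (L - y) := by
    ext y; exact RJ_eq L s u y
  have h1 : ∀ x ∈ Set.Ioo 0 L, HasDerivAt (RI s fun t => u (L - t))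
      (RI s (fun t => - u' (L - t)) x) x := by
    intro x hx
    have := RI_deriv hs hL (refl_cont hu) (refl_cont hu').neg (refl_deriv hd) hx
    rw [sub_zero, h0, zero_mul, zero_add] at this
    exact this
  have h2 := refl_deriv h1 x hx
  rw [e, RJ_eq]
  rw [RI_neg, neg_neg] at h2
  exact h2

lemma kernel_mvt {s : ℝ} (hs1 : s < 1) {h t : ℝ} (hh : 0 < h) (ht : h < t) :
    (1 - s) * h * t ^ (s - 2) ≤ (t - h) ^ (s - 1) - t ^ (s - 1) ∧
    (t - h) ^ (s - 1) - t ^ (s - 1) ≤ (1 - s) * h * (t - h) ^ (s - 2) := by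
  have hd : ∀ x ∈ Set.Icc (t - h) t, HasDerivAt (fun y : ℝ => y ^ (s - 1))
      ((s - 1) * x ^ (s - 1 - 1)) x := by
    intro x hx
    exact Real.hasDerivAt_rpow_const (Or.inl (by linarith [hx.1]))
  obtain ⟨ξ, hξ, he⟩ := exists_hasDerivAt_eq_slope (fun y : ℝ => y ^ (s - 1)) _
    (show t - h < t by linarith) (fun x hx => (hd x hx).continuousAt.continuousWithinAt)
    (fun x hx => hd x ⟨hx.1.le, hx.2.le⟩)
  rw [sub_sub_cancel, eq_div_iff hh.ne', show s - 1 - 1 = s - 2 by ring] at he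
  have h1 : t ^ (s - 2) ≤ ξ ^ (s - 2) :=
    Real.rpow_le_rpow_of_nonpos (by linarith [hξ.1]) hξ.2.le (by linarith)
  have h2 : ξ ^ (s - 2) ≤ (t - h) ^ (s - 2) :=
    Real.rpow_le_rpow_of_nonpos (by linarith) hξ.1.le (by linarith)
  have h3 : 0 < (1 - s) * h := mul_pos (by linarith) hh
  have h4 : (t - h) ^ (s - 1) - t ^ (s - 1) = (1 - s) * h * ξ ^ (s - 2) := by linarith
  rw [h4]
  exact ⟨mul_le_mul_of_nonneg_left h1 h3.le, mul_le_mul_of_nonneg_left h2 h3.le⟩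

lemma log_contra {s L : ℝ} (hs : 0 < s) (hs1 : s < 1) (hL : 0 < L) {f v : ℝ → ℝ}
    (hv : ContinuousOn v (Set.Icc 0 L)) (hv0 : 0 < v 0)
    (hf : ∀ x ∈ Set.Icc 0 L, f x = RI (1 - s) v x) {M : ℝ}
    (hM : ∀ h ∈ Set.Ioo 0 L, |RJ L s f h - RJ L s f 0| ≤ M * h) : False := by
  have hs' : 0 < 1 - s := by linarith
  have hfc : ContinuousOn f (Set.Icc 0 L) := (RI_cont hs' hL hv).congr hf
  obtain ⟨N, hN⟩ := isCompact_Icc.exists_bound_of_continuousOn hv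
  have hN0 : 0 ≤ N := (norm_nonneg _).trans (hN 0 ⟨le_rfl, hL.le⟩)
  obtain ⟨δ, hδ0, hδL, hδ⟩ : ∃ δ, 0 < δ ∧ δ < L ∧ ∀ t ∈ Set.Icc 0 δ, v 0 / 2 ≤ v t := by
    have h1 := (hv 0 ⟨le_rfl, hL.le⟩).eventually (lt_mem_nhds (show v 0 / 2 < v 0 by linarith))
    obtain ⟨ε, hε, h2⟩ := Metric.mem_nhdsWithin_iff.mp h1
    refine ⟨min (ε / 2) (L / 2), by positivity, (min_le_right _ _).trans_lt (by linarith), ?_⟩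
    intro t ht
    have h3 := ht.2.trans (min_le_left _ _)
    have h4 := ht.2.trans (min_le_right _ _)
    have : t ∈ {x | v 0 / 2 < v x} := by
      apply h2
      refine ⟨?_, ht.1, by linarith⟩
      rw [Metric.mem_ball, Real.dist_eq, sub_zero, abs_of_nonneg ht.1]
      linarith
    exact le_of_lt this
  set c0 := v 0 / 2 / (1 - s) with hc0
  have hc0p : 0 < c0 := by positivity
  have hlow : ∀ t ∈ Set.Icc 0 δ, c0 * t ^ (1 - s) ≤ f t := by
    intro t ht
    rw [hf t ⟨ht.1, ht.2.trans hδL.le⟩]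
    have := RI_mono (s := 1 - s) (L := δ) hs' (u := fun _ => v 0 / 2) continuousOn_const
      (hv.mono (Set.Icc_subset_Icc_right hδL.le)) ht
      (fun y hy => hδ y ⟨hy.1, hy.2.trans ht.2⟩)
    rw [RI_const hs'] at this
    calc c0 * t ^ (1 - s) = v 0 / 2 * (t ^ (1 - s) / (1 - s)) := by rw [hc0]; ring
      _ ≤ _ := this
  set C := N / (1 - s) with hC
  have hC0 : 0 ≤ C := by positivity
  have hup : ∀ t ∈ Set.Icc 0 L, |f t| ≤ C * t ^ (1 - s) := by
    intro t ht
    rw [hf t ht]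
    calc _ ≤ N * (t ^ (1 - s) / (1 - s)) := RI_bound hs' hv ht hN
      _ = _ := by rw [hC]; ring
  set B := C * L ^ (1 - s) with hB
  have hB0 : 0 ≤ B := by positivity
  have hfB : ∀ t ∈ Set.Icc 0 L, |f t| ≤ B := fun t ht => (hup t ht).trans
    (mul_le_mul_of_nonneg_left (Real.rpow_le_rpow ht.1 ht.2 hs'.le) hC0)
  set K := (1 - s) * (δ / 2) ^ (s - 2) * B * (L - δ) with hK
  have main : ∀ h, 0 < h → h < δ / 2 →
      c0 * (1 - s) * Real.log (δ / h) ≤ M + C + K := by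
    intro h hh hh2
    have hhL : h < L := by linarith
    have I1 : ∀ p q, 0 ≤ p → p ≤ q → q ≤ L →
        IntervalIntegrable (fun t => (t - h) ^ (s - 1) * f t) volume p q := by
      intro p q hp hpq hq
      apply (ker_int' hs p h q).mul_continuousOn
      rw [Set.uIcc_of_le hpq]
      exact hfc.mono (Set.Icc_subset_Icc hp hq)
    have I0 : ∀ p q, 0 ≤ p → p ≤ q → q ≤ L →
        IntervalIntegrable (fun t => (t - 0) ^ (s - 1) * f t) volume p q := by
      intro p q hp hpq hq
      apply (ker_int' hs p 0 q).mul_continuousOn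
      rw [Set.uIcc_of_le hpq]
      exact hfc.mono (Set.Icc_subset_Icc hp hq)
    have E : RJ L s f h - RJ L s f 0 =
        (∫ t in h..δ, (t - h) ^ (s - 1) * f t - (t - 0) ^ (s - 1) * f t)
        + (∫ t in δ..L, (t - h) ^ (s - 1) * f t - (t - 0) ^ (s - 1) * f t)
        - ∫ t in (0:ℝ)..h, (t - 0) ^ (s - 1) * f t := by
      unfold RJ
      rw [intervalIntegral.integral_sub (I1 h δ hh.le (by linarith) hδL.le)
        (I0 h δ hh.le (by linarith) hδL.le),
        intervalIntegral.integral_sub (I1 δ L hδ0.le hδL.le le_rfl) (I0 δ L hδ0.le hδL.le le_rfl),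
        ← intervalIntegral.integral_add_adjacent_intervals (I1 h δ hh.le (by linarith) hδL.le)
          (I1 δ L hδ0.le hδL.le le_rfl),
        ← intervalIntegral.integral_add_adjacent_intervals (I0 0 h le_rfl hh.le hhL.le)
          (I0 h L hh.le hhL.le le_rfl),
        ← intervalIntegral.integral_add_adjacent_intervals (I0 h δ hh.le (by linarith) hδL.le)
          (I0 δ L hδ0.le hδL.le le_rfl)]
      ring
    have A1 : c0 * (1 - s) * h * Real.log (δ / h) ≤
        ∫ t in h..δ, (t - h) ^ (s - 1) * f t - (t - 0) ^ (s - 1) * f t := by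
      rw [← integral_inv_of_pos hh hδ0, ← intervalIntegral.integral_const_mul]
      apply intervalIntegral.integral_mono_on_of_le_Ioo (by linarith)
      · apply IntervalIntegrable.const_mul
        apply intervalIntegral.intervalIntegrable_inv
        · intro x hx
          rw [Set.uIcc_of_le (by linarith)] at hx
          linarith [hx.1]
        · exact continuousOn_id
      · exact (I1 h δ hh.le (by linarith) hδL.le).sub (I0 h δ hh.le (by linarith) hδL.le)
      · intro t ht
        have ht0 : 0 < t := hh.trans ht.1
        rw [sub_zero, ← sub_mul]
        calc c0 * (1 - s) * h * t⁻¹ = (1 - s) * h * t ^ (s - 2) * (c0 * t ^ (1 - s)) := by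
              rw [← Real.rpow_neg_one t, show (-1:ℝ) = (s - 2) + (1 - s) by ring,
                Real.rpow_add ht0]
              ring
          _ ≤ _ := by
              apply mul_le_mul (kernel_mvt hs1 hh ht.1).1 (hlow t ⟨ht0.le, ht.2.le⟩)
              · positivity
              · exact le_trans (by positivity) (kernel_mvt hs1 hh ht.1).1
    have A2 : |∫ t in δ..L, (t - h) ^ (s - 1) * f t - (t - 0) ^ (s - 1) * f t| ≤ K * h := by
      have : ‖∫ t in δ..L, (t - h) ^ (s - 1) * f t - (t - 0) ^ (s - 1) * f t‖ ≤
          ((1 - s) * h * (δ / 2) ^ (s - 2) * B) * |L - δ| := by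
        apply intervalIntegral.norm_integral_le_of_norm_le_const
        intro t ht
        rw [Set.uIoc_of_le hδL.le] at ht
        have hht : h < t := by linarith [ht.1]
        have km := kernel_mvt hs1 hh hht
        have ht0 : 0 < t := by linarith
        rw [sub_zero, ← sub_mul, Real.norm_eq_abs, abs_mul]
        have hnn : 0 ≤ (t - h) ^ (s - 1) - t ^ (s - 1) := le_trans (by positivity) km.1
        rw [abs_of_nonneg hnn]
        apply mul_le_mul _ (hfB t ⟨ht0.le, ht.2⟩) (abs_nonneg _) (by positivity)
        refine km.2.trans ?_
        apply mul_le_mul_of_nonneg_left _ (by positivity)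
        exact Real.rpow_le_rpow_of_nonpos (by linarith) (by linarith [ht.1]) (by linarith)
      rw [abs_of_pos (by linarith : 0 < L - δ)] at this
      calc _ ≤ _ := this
        _ = K * h := by rw [hK]; ring
    have A3 : |∫ t in (0:ℝ)..h, (t - 0) ^ (s - 1) * f t| ≤ C * h := by
      have : ‖∫ t in (0:ℝ)..h, (t - 0) ^ (s - 1) * f t‖ ≤ C * |h - 0| := by
        apply intervalIntegral.norm_integral_le_of_norm_le_const
        intro t ht
        rw [Set.uIoc_of_le hh.le] at ht
        have ht0 := ht.1
        rw [sub_zero, Real.norm_eq_abs, abs_mul, abs_of_pos (by positivity)]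
        calc _ ≤ t ^ (s - 1) * (C * t ^ (1 - s)) := by
              apply mul_le_mul_of_nonneg_left (hup t ⟨ht0.le, by linarith [ht.2]⟩) (by positivity)
          _ = C * (t ^ (s - 1) * t ^ (1 - s)) := by ring
          _ = C := by rw [← Real.rpow_add ht0]; simp
      rwa [sub_zero, abs_of_pos hh] at this
    have A4 := hM h ⟨hh, hhL⟩
    rw [E] at A4
    have B2 := (abs_le.mp A2).1
    have B3 := (abs_le.mp A3).2
    have B4 := (abs_le.mp A4).2
    have : h * (c0 * (1 - s) * Real.log (δ / h)) ≤ h * (M + C + K) := by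
      nlinarith
    exact le_of_mul_le_mul_left this hh
  set Q := max 1 ((M + C + K + 1) / (c0 * (1 - s))) with hQ
  have h1 := main (δ * Real.exp (-Q)) (by positivity) (by
    have : Real.exp (-Q) ≤ Real.exp (-1) := Real.exp_le_exp.mpr (by simp [hQ])
    have h2 : Real.exp (-1) < 1 / 2 := by
      have := Real.exp_neg_one_lt_d9
      linarith
    nlinarith)
  have h2 : δ / (δ * Real.exp (-Q)) = Real.exp Q := by
    rw [Real.exp_neg]; field_simp
  rw [h2, Real.log_exp] at h1
  have h3 : (M + C + K + 1) / (c0 * (1 - s)) ≤ Q := le_max_right _ _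
  rw [div_le_iff₀ (by positivity)] at h3
  linarith

/-- Abel inversion. -/
lemma abel {s L : ℝ} (hs : 0 < s) (hs1 : s < 1) (hL : 0 < L) {f F1 : ℝ → ℝ}
    (hf : ContinuousOn f (Set.Icc 0 L)) (hF1 : ContinuousOn F1 (Set.Icc 0 L))
    (hF : ∀ x ∈ Set.Ioo 0 L, HasDerivAt (RI s f) (F1 x) x) :
    ∃ c, ∀ x ∈ Set.Icc 0 L, f x = c * RI (1 - s) F1 x ∧ 0 < c := by
  have hs' : 0 < 1 - s := by linarith
  set B := ∫ t in (0:ℝ)..1, (1 - t) ^ (1 - s - 1) * t ^ (s - 1) with hB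
  have hBp : 0 < B := beta_pos hs' hs
  refine ⟨B⁻¹, ?_⟩
  suffices h : Set.EqOn f (fun x => B⁻¹ * RI (1 - s) F1 x) (Set.Icc 0 L) from
    fun x hx => ⟨h hx, by positivity⟩
  apply eqOn_Icc hL hf (continuousOn_const.mul (RI_cont hs' hL hF1))
  intro x hx
  have h1 := RI_deriv hs' hL (RI_cont hs hL hf) hF1 hF hx
  rw [RI_zero, zero_mul, zero_add] at h1
  have h2 : HasDerivAt (fun y => B * ∫ t in (0:ℝ)..y, f t) (B * f x) x :=
    (int_deriv hf hx).const_mul B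
  have h3 : RI (1 - s) (RI s f) =ᶠ[nhds x] (fun y => B * ∫ t in (0:ℝ)..y, f t) := by
    filter_upwards [Icc_mem_nhds hx.1 hx.2] with y hy
    rw [semigroup hs' hs hL hf hy, sub_add_cancel, RI_one]
  have h4 := (h2.congr_of_eventuallyEq h3).unique h1
  show f x = B⁻¹ * RI (1 - s) F1 x
  rw [← h4]
  field_simp

lemma end_zero {s L : ℝ} (hs : 0 < s) (hs1 : s < 1) (hL : 0 < L) {f F1 G1 : ℝ → ℝ}
    (hf : ContinuousOn f (Set.Icc 0 L)) (hF1 : ContinuousOn F1 (Set.Icc 0 L))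
    (hF : ∀ x ∈ Set.Ioo 0 L, HasDerivAt (RI s f) (F1 x) x)
    (hG1 : ContinuousOn G1 (Set.Icc 0 L))
    (hG : ∀ x ∈ Set.Ioo 0 L, HasDerivAt (RJ L s f) (G1 x) x) : f 0 = 0 ∧ f L = 0 := by
  constructor
  · obtain ⟨c, hc⟩ := abel hs hs1 hL hf hF1 hF
    rw [(hc 0 ⟨le_rfl, hL.le⟩).1, RI_zero, mul_zero]
  · have e : (RI s fun t => f (L - t)) = fun y => RJ L s f (L - y) := by
      ext y
      rw [RJ_eq, sub_sub_cancel]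
    obtain ⟨c, hc⟩ := abel hs hs1 hL (refl_cont hf) (refl_cont hG1).neg
      (by rw [e]; exact refl_deriv hG)
    have := (hc 0 ⟨le_rfl, hL.le⟩).1
    rwa [RI_zero, mul_zero, sub_zero] at this

lemma step {s L : ℝ} (hs : 0 < s) (hs1 : s < 1) (hL : 0 < L) {f F1 G1 F2 : ℝ → ℝ}
    (hf : ContinuousOn f (Set.Icc 0 L)) (hF1 : ContinuousOn F1 (Set.Icc 0 L))
    (hF : ∀ x ∈ Set.Ioo 0 L, HasDerivAt (RI s f) (F1 x) x)
    (hG1 : ContinuousOn G1 (Set.Icc 0 L))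
    (hG : ∀ x ∈ Set.Ioo 0 L, HasDerivAt (RJ L s f) (G1 x) x)
    (hF2 : ContinuousOn F2 (Set.Icc 0 L))
    (hF' : ∀ x ∈ Set.Ioo 0 L, HasDerivAt F1 (F2 x) x) :
    ∃ f1 : ℝ → ℝ, ContinuousOn f1 (Set.Icc 0 L) ∧ (∀ x ∈ Set.Ioo 0 L, HasDerivAt f (f1 x) x) ∧
      Set.EqOn (RI s f1) F1 (Set.Icc 0 L) ∧ Set.EqOn (RJ L s f1) G1 (Set.Icc 0 L) := by
  have hs' : 0 < 1 - s := by linarith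
  obtain ⟨h0, h1⟩ := end_zero hs hs1 hL hf hF1 hF hG1 hG
  obtain ⟨c, hc⟩ := abel hs hs1 hL hf hF1 hF
  have hcp := (hc 0 ⟨le_rfl, hL.le⟩).2
  replace hc := fun x hx => (hc x hx).1
  obtain ⟨M, hM⟩ := isCompact_Icc.exists_bound_of_continuousOn hG1
  have hJ : ∀ h ∈ Set.Ioo 0 L, |RJ L s f h - RJ L s f 0| ≤ M * h := by
    intro h hh
    rw [ftc (RJ_cont hs hL hf) hG1 hG ⟨hh.1.le, hh.2.le⟩, add_sub_cancel_left]
    have : ‖∫ t in (0:ℝ)..h, G1 t‖ ≤ M * |h - 0| := by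
      apply intervalIntegral.norm_integral_le_of_norm_le_const
      intro t ht
      rw [Set.uIoc_of_le hh.1.le] at ht
      exact hM t ⟨ht.1.le, ht.2.trans hh.2.le⟩
    rwa [sub_zero, abs_of_pos hh.1] at this
  have hF10 : F1 0 = 0 := by
    rcases lt_trichotomy (F1 0) 0 with h | h | h
    · exfalso
      apply log_contra hs hs1 hL (f := fun t => - f t) (v := fun t => (-c) * F1 t)
        (continuousOn_const.mul hF1) (by nlinarith) _ (M := M)
      · intro x hx
        rw [RJ_neg, RJ_neg, neg_sub_neg, abs_sub_comm]
        exact hJ x hx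
      · intro x hx
        rw [RI_const_mul, hc x hx]; ring
    · exact h
    · exfalso
      apply log_contra hs hs1 hL (f := f) (v := fun t => c * F1 t)
        (continuousOn_const.mul hF1) (by positivity) _ hJ
      intro x hx
      rw [RI_const_mul, hc x hx]
  have hf1c : ContinuousOn (fun x => c * RI (1 - s) F2 x) (Set.Icc 0 L) :=
    continuousOn_const.mul (RI_cont hs' hL hF2)
  have hd : ∀ x ∈ Set.Ioo 0 L, HasDerivAt f (c * RI (1 - s) F2 x) x := by
    intro x hx
    have := RI_deriv hs' hL hF1 hF2 hF' hx
    rw [hF10, zero_mul, zero_add] at this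
    refine (this.const_mul c).congr_of_eventuallyEq ?_
    filter_upwards [Icc_mem_nhds hx.1 hx.2] with y hy using hc y hy
  refine ⟨fun x => c * RI (1 - s) F2 x, hf1c, hd, ?_, ?_⟩
  · apply eqOn_Icc hL (RI_cont hs hL hf1c) hF1
    intro x hx
    have := RI_deriv hs hL hf hf1c hd hx
    rw [h0, zero_mul, zero_add] at this
    exact this.unique (hF x hx)
  · apply eqOn_Icc hL (RJ_cont hs hL hf1c) hG1
    intro x hx
    exact (RJ_deriv hs hL hf h1 hf1c hd hx).unique (hG x hx)

/-- A chain of successive derivatives on the open interval. -/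
def DChain (N : ℕ) (L : ℝ) (u : ℕ → ℝ → ℝ) : Prop :=
  ∀ k < N, ∀ x ∈ Set.Ioo 0 L, HasDerivAt (u k) (u (k + 1) x) x

/-- All members of the chain are continuous on the closed interval. -/
def CChain (N : ℕ) (L : ℝ) (u : ℕ → ℝ → ℝ) : Prop :=
  ∀ k ≤ N, ContinuousOn (u k) (Set.Icc 0 L)

lemma P_form {s L : ℝ} (hs : 0 < s) (hL : 0 < L) {N : ℕ} {g P : ℕ → ℝ → ℝ}
    (hgc : CChain N L g) (hgd : DChain N L g) (hg0 : g 0 0 = 0) (hPd : DChain N L P)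
    (hP0 : ∀ x ∈ Set.Ioo 0 L, P 0 x = RI s (g 0) x) :
    ∀ m < N, ∃ c : ℕ → ℝ, ∀ x ∈ Set.Ioo 0 L,
      P (m + 1) x = RI s (g (m + 1)) x + ∑ j ∈ Finset.range m, c j * x ^ (s + j - m) := by
  intro m
  induction m with
  | zero =>
    intro hm
    refine ⟨0, fun x hx => ?_⟩
    have h1 := RI_deriv hs hL (hgc 0 (by omega)) (hgc 1 (by omega)) (hgd 0 hm) hx
    rw [hg0, zero_mul, zero_add] at h1
    have h2 : P 0 =ᶠ[nhds x] RI s (g 0) := by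
      filter_upwards [Ioo_mem_nhds hx.1 hx.2] with y hy using hP0 y hy
    simp only [zero_add, Finset.range_zero, Finset.sum_empty, add_zero]
    exact (hPd 0 hm x hx).unique (h1.congr_of_eventuallyEq h2)
  | succ m ih =>
    intro hm
    obtain ⟨c, hc⟩ := ih (by omega)
    refine ⟨fun j => if j < m then c j * (s + j - m) else g (m + 1) 0, fun x hx => ?_⟩
    have h1 := RI_deriv hs hL (hgc (m + 1) (by omega)) (hgc (m + 2) (by omega)) (hgd (m + 1) hm) hx
    have h2 : HasDerivAt (fun y : ℝ => ∑ j ∈ Finset.range m, c j * y ^ (s + j - m))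
        (∑ j ∈ Finset.range m, c j * ((s + j - m) * x ^ (s + j - m - 1))) x := by
      apply HasDerivAt.fun_sum
      intro j _
      exact (Real.hasDerivAt_rpow_const (Or.inl hx.1.ne')).const_mul (c j)
    have h3 : P (m + 1) =ᶠ[nhds x]
        fun y => RI s (g (m + 1)) y + ∑ j ∈ Finset.range m, c j * y ^ (s + j - m) := by
      filter_upwards [Ioo_mem_nhds hx.1 hx.2] with y hy using hc y hy
    have h4 := (hPd (m + 1) hm x hx).unique ((h1.add h2).congr_of_eventuallyEq h3)
    rw [h4, Finset.sum_range_succ]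
    have h5 : ∑ j ∈ Finset.range m, (if j < m then c j * (s + j - m) else g (m + 1) 0) *
        x ^ (s + (j:ℝ) - ((m + 1 : ℕ) : ℝ))
        = ∑ j ∈ Finset.range m, c j * ((s + j - m) * x ^ (s + j - m - 1)) := by
      apply Finset.sum_congr rfl
      intro j hj
      rw [if_pos (Finset.mem_range.mp hj)]
      push_cast
      rw [show s + (j:ℝ) - (m + 1) = s + j - m - 1 by ring]
      ring
    rw [h5]
    simp only [lt_irrefl, if_false]
    push_cast
    rw [show s + (m:ℝ) - (m + 1) = s - 1 by ring]
    ring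

lemma P_bound {s L : ℝ} (hs : 0 < s) (hL : 0 < L) {N : ℕ} {g P : ℕ → ℝ → ℝ}
    (hgc : CChain N L g) (hgd : DChain N L g) (hg0 : g 0 0 = 0) (hPd : DChain N L P)
    (hP0 : ∀ x ∈ Set.Ioo 0 L, P 0 x = RI s (g 0) x) (m : ℕ) (hm : m < N) :
    ContinuousOn (P (m + 1)) (Set.Ioo 0 L) ∧
    ∃ C, 0 ≤ C ∧ ∀ x ∈ Set.Ioo 0 L, |P (m + 1) x| ≤ C * x ^ (s - m) := by
  obtain ⟨c, hc⟩ := P_form hs hL hgc hgd hg0 hPd hP0 m hm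
  constructor
  · refine ContinuousOn.congr ?_ hc
    apply ((RI_cont hs hL (hgc (m + 1) hm)).mono Set.Ioo_subset_Icc_self).add
    apply continuousOn_finsetSum
    intro j _
    apply continuousOn_const.mul
    intro x hx
    exact (Real.continuousAt_rpow_const _ _ (Or.inl hx.1.ne')).continuousWithinAt
  · obtain ⟨M, hM⟩ := isCompact_Icc.exists_bound_of_continuousOn (hgc (m + 1) hm)
    have hM0 : 0 ≤ M := (norm_nonneg _).trans (hM 0 ⟨le_rfl, hL.le⟩)
    have hpow : ∀ x ∈ Set.Ioo 0 L, ∀ j : ℕ, x ^ (s + j - m) ≤ L ^ j * x ^ (s - m) := by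
      intro x hx j
      rw [show s + (j:ℝ) - m = j + (s - m) by ring, Real.rpow_add hx.1, Real.rpow_natCast]
      apply mul_le_mul_of_nonneg_right _ (Real.rpow_nonneg hx.1.le _)
      exact pow_le_pow_left₀ hx.1.le hx.2.le j
    refine ⟨M / s * L ^ m + ∑ j ∈ Finset.range m, |c j| * L ^ j, by positivity, fun x hx => ?_⟩
    rw [hc x hx, add_mul, Finset.sum_mul]
    refine (abs_add_le _ _).trans (add_le_add ?_ ?_)
    · refine (RI_bound hs (hgc (m + 1) hm) ⟨hx.1.le, hx.2.le⟩ hM).trans ?_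
      have := hpow x hx m
      rw [show s + (m:ℝ) - m = s by ring] at this
      calc M * (x ^ s / s) = M / s * x ^ s := by ring
        _ ≤ M / s * (L ^ m * x ^ (s - m)) := by gcongr
        _ = _ := by ring
    · refine (Finset.abs_sum_le_sum_abs _ _).trans (Finset.sum_le_sum fun j _ => ?_)
      rw [abs_mul, abs_of_nonneg (Real.rpow_nonneg hx.1.le _), mul_assoc]
      exact mul_le_mul_of_nonneg_left (hpow x hx j) (abs_nonneg _)

lemma int_congr_Ioo {L : ℝ} (hL : 0 < L) {u v : ℝ → ℝ} (h : ∀ x ∈ Set.Ioo 0 L, u x = v x) :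
    ∫ t in (0:ℝ)..L, u t = ∫ t in (0:ℝ)..L, v t := by
  rw [intervalIntegral.integral_of_le hL.le, intervalIntegral.integral_of_le hL.le,
    integral_Ioc_eq_integral_Ioo, integral_Ioc_eq_integral_Ioo]
  exact setIntegral_congr_fun measurableSet_Ioo h

lemma bdd_int {L : ℝ} (hL : 0 < L) {u : ℝ → ℝ} {C : ℝ} (hu : ContinuousOn u (Set.Ioo 0 L))
    (hC : ∀ x ∈ Set.Ioo 0 L, |u x| ≤ C) : IntervalIntegrable u volume 0 L := by
  rw [intervalIntegrable_iff_integrableOn_Ioo_of_le hL.le]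
  have hcst : IntegrableOn (fun _ : ℝ => C) (Set.Ioo 0 L) volume := integrableOn_const (by simp)
  refine Integrable.mono' hcst (hu.aestronglyMeasurable measurableSet_Ioo) ?_
  filter_upwards [ae_restrict_mem measurableSet_Ioo] with x hx using hC x hx

theorem core_left {s L : ℝ} (hs : 0 < s) (hs1 : s < 1) (hL : 0 < L) {N : ℕ} {g P : ℕ → ℝ → ℝ}
    (hgc : CChain N L g) (hgd : DChain N L g) (hg0 : g 0 0 = 0) (hgL : g 0 L = 0)
    (hPd : DChain N L P) (hP0 : ∀ x ∈ Set.Ioo 0 L, P 0 x = RI s (g 0) x) :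
    ∀ m < N, ∀ (f : ℝ → ℝ) (F G : ℕ → ℝ → ℝ), ContinuousOn f (Set.Icc 0 L) →
      CChain (m + 1) L F → DChain (m + 1) L F → CChain (m + 1) L G → DChain (m + 1) L G →
      Set.EqOn (RI s f) (F 0) (Set.Icc 0 L) → Set.EqOn (RJ L s f) (G 0) (Set.Icc 0 L) →
      (∃ C, 0 ≤ C ∧ ∀ x ∈ Set.Icc 0 L, |f x| ≤ C * x ^ m) ∧
      IntervalIntegrable (fun x => f x * P (m + 1) x) volume 0 L ∧
      ∫ x in (0:ℝ)..L, f x * P (m + 1) x = (-1) ^ (m + 1) * ∫ x in (0:ℝ)..L, G (m + 1) x * g 0 x := by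
  intro m
  induction m with
  | zero =>
    intro hm f F G hf hFc hFd hGc hGd hF hG
    obtain ⟨M, hM⟩ := isCompact_Icc.exists_bound_of_continuousOn hf
    have hM0 : 0 ≤ M := (norm_nonneg _).trans (hM 0 ⟨le_rfl, hL.le⟩)
    obtain ⟨c, hc⟩ := P_form hs hL hgc hgd hg0 hPd hP0 0 hm
    simp only [zero_add, Finset.range_zero, Finset.sum_empty, add_zero] at hc
    have hprod : ContinuousOn (fun x => f x * RI s (g 1) x) (Set.Icc 0 L) :=
      hf.mul (RI_cont hs hL (hgc 1 hm))
    have hi := hprod.intervalIntegrable_of_Icc (μ := volume) hL.le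
    refine ⟨⟨M, hM0, fun x hx => by simpa using hM x hx⟩, ?_, ?_⟩
    · refine hi.congr_uIoo ?_
      intro x hx
      rw [Set.uIoo_of_le hL.le] at hx
      simp only [zero_add]
      rw [hc x hx]
    · have e1 : ∫ x in (0:ℝ)..L, f x * P (0 + 1) x = ∫ x in (0:ℝ)..L, f x * RI s (g 1) x :=
        int_congr_Ioo hL fun x hx => by simp only [zero_add]; rw [hc x hx]
      have e2 : ∫ x in (0:ℝ)..L, RJ L s f x * g 1 x = ∫ x in (0:ℝ)..L, G 0 x * g 1 x :=
        int_congr_Ioo hL fun x hx => by rw [hG ⟨hx.1.le, hx.2.le⟩]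
      rw [e1, duality hs hL hf (hgc 1 hm), e2]
      have := intervalIntegral.integral_mul_deriv_eq_deriv_mul_of_hasDerivAt
        (u := G 0) (v := g 0) (u' := G 1) (v' := g 1) (a := 0) (b := L)
        (by rw [Set.uIcc_of_le hL.le]; exact hGc 0 (by omega))
        (by rw [Set.uIcc_of_le hL.le]; exact hgc 0 (by omega))
        (by rw [min_eq_left hL.le, max_eq_right hL.le]; exact hGd 0 (by omega))
        (by rw [min_eq_left hL.le, max_eq_right hL.le]; exact hgd 0 hm)
        ((hGc 1 (by omega)).intervalIntegrable_of_Icc hL.le)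
        ((hgc 1 hm).intervalIntegrable_of_Icc hL.le)
      rw [this, hg0, hgL]
      simp
  | succ m ih =>
    intro hm f F G hf hFc hFd hGc hGd hF hG
    have hRF : ∀ x ∈ Set.Ioo 0 L, HasDerivAt (RI s f) (F 1 x) x := by
      intro x hx
      refine (hFd 0 (by omega) x hx).congr_of_eventuallyEq ?_
      filter_upwards [Icc_mem_nhds hx.1 hx.2] with y hy using hF hy
    have hRG : ∀ x ∈ Set.Ioo 0 L, HasDerivAt (RJ L s f) (G 1 x) x := by
      intro x hx
      refine (hGd 0 (by omega) x hx).congr_of_eventuallyEq ?_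
      filter_upwards [Icc_mem_nhds hx.1 hx.2] with y hy using hG hy
    obtain ⟨h0, h1⟩ := end_zero hs hs1 hL hf (hFc 1 (by omega)) hRF (hGc 1 (by omega)) hRG
    obtain ⟨f1, hf1, hd, hF1, hG1⟩ := step hs hs1 hL hf (hFc 1 (by omega)) hRF
      (hGc 1 (by omega)) hRG (hFc 2 (by omega)) (hFd 1 (by omega))
    obtain ⟨⟨C, hC0, hC⟩, hi1, he1⟩ := ih (by omega) f1 (fun k => F (k + 1)) (fun k => G (k + 1)) hf1
      (fun k hk => hFc (k + 1) (by omega)) (fun k hk => hFd (k + 1) (by omega))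
      (fun k hk => hGc (k + 1) (by omega)) (fun k hk => hGd (k + 1) (by omega)) hF1 hG1
    have hfb : ∀ x ∈ Set.Icc 0 L, |f x| ≤ C * x ^ (m + 1) := by
      intro x hx
      rw [ftc hf hf1 hd hx, h0, zero_add]
      have : ‖∫ t in (0:ℝ)..x, f1 t‖ ≤ (C * x ^ m) * |x - 0| := by
        apply intervalIntegral.norm_integral_le_of_norm_le_const
        intro t ht
        rw [Set.uIoc_of_le hx.1] at ht
        refine (hC t ⟨ht.1.le, ht.2.trans hx.2⟩).trans ?_
        have := ht.1.le
        have := ht.2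
        gcongr
      rw [sub_zero, abs_of_nonneg hx.1] at this
      calc _ ≤ _ := this
        _ = _ := by ring
    obtain ⟨hc1, C1, hC10, hb1⟩ := P_bound hs hL hgc hgd hg0 hPd hP0 m (by omega)
    obtain ⟨hc2, C2, hC20, hb2⟩ := P_bound hs hL hgc hgd hg0 hPd hP0 (m + 1) hm
    have hi2 : IntervalIntegrable (fun x => f x * P (m + 1 + 1) x) volume 0 L := by
      apply bdd_int hL (C := C * C2 * L ^ s)
      · exact (hf.mono Set.Ioo_subset_Icc_self).mul hc2
      · intro x hx
        have hx0 := hx.1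
        rw [abs_mul]
        calc |f x| * |P (m + 1 + 1) x| ≤ (C * x ^ (m + 1)) * (C2 * x ^ (s - (m + 1 : ℕ))) :=
              mul_le_mul (hfb x ⟨hx.1.le, hx.2.le⟩) (hb2 x hx) (abs_nonneg _) (by positivity)
          _ = C * C2 * (x ^ ((m + 1 : ℕ) : ℝ) * x ^ (s - (m + 1 : ℕ))) := by
              rw [Real.rpow_natCast]; ring
          _ = C * C2 * x ^ s := by rw [← Real.rpow_add hx.1]; congr 2; ring
          _ ≤ _ := by
              have := hx.2.le
              gcongr
    refine ⟨⟨C, hC0, hfb⟩, hi2, ?_⟩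
    have lim0 : Filter.Tendsto (fun x => f x * P (m + 1) x) (nhdsWithin 0 (Set.Ioi 0)) (nhds 0) := by
      have l1 : Filter.Tendsto (fun x : ℝ => C * C1 * x ^ (s + 1)) (nhdsWithin 0 (Set.Ioi 0))
          (nhds 0) := by
        have : Filter.Tendsto (fun x : ℝ => C * C1 * x ^ (s + 1)) (nhds 0)
            (nhds (C * C1 * 0 ^ (s + 1))) :=
          ((Real.continuous_rpow_const (by linarith)).const_mul _).tendsto 0 |>.comp
            Filter.tendsto_id
        rw [Real.zero_rpow (by linarith), mul_zero] at this
        exact this.mono_left nhdsWithin_le_nhds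
      refine squeeze_zero_norm' ?_ l1
      filter_upwards [Ioo_mem_nhdsGT hL] with x hx
      have hx0 := hx.1
      rw [Real.norm_eq_abs, abs_mul]
      calc |f x| * |P (m + 1) x| ≤ (C * x ^ (m + 1)) * (C1 * x ^ (s - m)) :=
            mul_le_mul (hfb x ⟨hx.1.le, hx.2.le⟩) (hb1 x hx) (abs_nonneg _) (by positivity)
        _ = C * C1 * (x ^ ((m + 1 : ℕ) : ℝ) * x ^ (s - m)) := by
            rw [Real.rpow_natCast]; ring
        _ = C * C1 * x ^ (s + 1) := by
            rw [← Real.rpow_add hx.1]; congr 2; push_cast; ring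
    have limL : Filter.Tendsto (fun x => f x * P (m + 1) x) (nhdsWithin L (Set.Iio L)) (nhds 0) := by
      have l0 : Filter.Tendsto f (nhdsWithin L (Set.Iio L)) (nhds 0) := by
        have := hf L ⟨hL.le, le_rfl⟩
        rw [ContinuousWithinAt, h1] at this
        refine this.mono_left ?_
        rw [← nhdsWithin_Ioo_eq_nhdsLT hL]
        exact nhdsWithin_mono _ Set.Ioo_subset_Icc_self
      have l1 : Filter.Tendsto (fun x : ℝ => |f x| * (C1 * x ^ (s - m))) (nhdsWithin L (Set.Iio L))
          (nhds 0) := by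
        have h2 : Filter.Tendsto (fun x : ℝ => C1 * x ^ (s - m)) (nhdsWithin L (Set.Iio L))
            (nhds (C1 * L ^ (s - m))) :=
          ((Real.continuousAt_rpow_const L (s - m) (Or.inl hL.ne')).tendsto.const_mul C1).mono_left
            nhdsWithin_le_nhds
        have := l0.abs.mul h2
        rwa [abs_zero, zero_mul] at this
      refine squeeze_zero_norm' ?_ l1
      filter_upwards [Ioo_mem_nhdsLT hL] with x hx
      rw [Real.norm_eq_abs, abs_mul]
      exact mul_le_mul_of_nonneg_left (hb1 x hx) (abs_nonneg _)
    have hparts := intervalIntegral.integral_eq_sub_of_hasDerivAt_of_tendsto hL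
      (f := fun x => f x * P (m + 1) x)
      (f' := fun x => f1 x * P (m + 1) x + f x * P (m + 1 + 1) x)
      (fun x hx => (hd x hx).mul (hPd (m + 1) hm x hx)) (hi1.add hi2) lim0 limL
    rw [intervalIntegral.integral_add hi1 hi2, he1] at hparts
    rw [pow_succ]
    linarith

lemma CChain.refl {N : ℕ} {L : ℝ} {u : ℕ → ℝ → ℝ} (h : CChain N L u) :
    CChain N L (fun k x => (-1) ^ k * u k (L - x)) :=
  fun k hk => continuousOn_const.mul (refl_cont (h k hk))

lemma DChain.refl {N : ℕ} {L : ℝ} {u : ℕ → ℝ → ℝ} (h : DChain N L u) :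
    DChain N L (fun k x => (-1) ^ k * u k (L - x)) := by
  intro k hk x hx
  have := (refl_deriv (h k hk) x hx).const_mul ((-1) ^ k)
  have e : (-1) ^ (k + 1) * u (k + 1) (L - x) = (-1) ^ k * -u (k + 1) (L - x) := by ring
  simp only
  rw [e]
  exact this

lemma RI_refl (L s : ℝ) (u : ℝ → ℝ) (x : ℝ) : RI s (fun t => u (L - t)) x = RJ L s u (L - x) := by
  rw [RJ_eq, sub_sub_cancel]

lemma RJ_refl (L s : ℝ) (u : ℝ → ℝ) (x : ℝ) : RJ L s (fun t => u (L - t)) x = RI s u (L - x) := by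
  rw [RJ_eq]
  simp only [sub_sub_cancel]

theorem core_right {s L : ℝ} (hs : 0 < s) (hs1 : s < 1) (hL : 0 < L) {n : ℕ} (hn : 0 < n)
    {g Q : ℕ → ℝ → ℝ}
    (hgc : CChain n L g) (hgd : DChain n L g) (hg0 : g 0 0 = 0) (hgL : g 0 L = 0)
    (hQd : DChain n L Q) (hQ0 : ∀ x ∈ Set.Ioo 0 L, Q 0 x = RJ L s (g 0) x)
    (f : ℝ → ℝ) (F G : ℕ → ℝ → ℝ) (hf : ContinuousOn f (Set.Icc 0 L))
    (hFc : CChain n L F) (hFd : DChain n L F) (hGc : CChain n L G) (hGd : DChain n L G)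
    (hF : Set.EqOn (RI s f) (F 0) (Set.Icc 0 L)) (hG : Set.EqOn (RJ L s f) (G 0) (Set.Icc 0 L)) :
      IntervalIntegrable (fun x => f x * Q n x) volume 0 L ∧
      ∫ x in (0:ℝ)..L, f x * Q n x = (-1) ^ n * ∫ x in (0:ℝ)..L, F n x * g 0 x := by
  obtain ⟨m, rfl⟩ := Nat.exists_eq_add_of_lt hn
  rw [zero_add] at *
  have hmem : ∀ x ∈ Set.Icc 0 L, L - x ∈ Set.Icc 0 L :=
    fun x hx => ⟨by linarith [hx.2], by linarith [hx.1]⟩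
  obtain ⟨-, h1, h2⟩ := core_left hs hs1 hL hgc.refl hgd.refl (by simpa using hgL)
    (by simpa using hg0) hQd.refl
    (by
      intro x hx
      simp only [pow_zero, one_mul]
      rw [RI_refl, hQ0 _ ⟨by linarith [hx.2], by linarith [hx.1]⟩]) m (by omega)
    (fun t => f (L - t)) _ _ (refl_cont hf) hGc.refl hGd.refl hFc.refl hFd.refl
    (by
      intro x hx
      simp only [pow_zero, one_mul]
      rw [RI_refl, hG (hmem x hx)])
    (by
      intro x hx
      simp only [pow_zero, one_mul]
      rw [RJ_refl, hF (hmem x hx)])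
  have hsq : ((-1:ℝ) ^ (m + 1)) * (-1) ^ (m + 1) = 1 := by
    rw [← mul_pow]; simp
  constructor
  · have h3 := (h1.comp_sub_left L).const_mul ((-1) ^ (m + 1))
    simp only [sub_sub_cancel, sub_zero, sub_self] at h3
    refine h3.symm.congr_uIoo ?_
    intro x _
    simp only
    calc _ = (((-1:ℝ) ^ (m + 1)) * (-1) ^ (m + 1)) * (f x * Q (m + 1) x) := by ring
      _ = _ := by rw [hsq, one_mul]
  · have e1 : ∫ x in (0:ℝ)..L, f (L - x) * ((-1) ^ (m + 1) * Q (m + 1) (L - x))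
        = (-1) ^ (m + 1) * ∫ x in (0:ℝ)..L, f x * Q (m + 1) x := by
      rw [intervalIntegral.integral_comp_sub_left
        (fun y => f y * ((-1) ^ (m + 1) * Q (m + 1) y)) L, sub_self, sub_zero,
        ← intervalIntegral.integral_const_mul]
      congr 1; ext x; ring
    have e2 : ∫ x in (0:ℝ)..L, (-1) ^ (m + 1) * F (m + 1) (L - x) * ((-1) ^ 0 * g 0 (L - x))
        = (-1) ^ (m + 1) * ∫ x in (0:ℝ)..L, F (m + 1) x * g 0 x := by
      rw [intervalIntegral.integral_comp_sub_left
        (fun y => (-1) ^ (m + 1) * F (m + 1) y * ((-1) ^ 0 * g 0 y)) L, sub_self, sub_zero,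
        ← intervalIntegral.integral_const_mul]
      congr 1; ext x; ring
    rw [e1, e2] at h2
    have hne : ((-1:ℝ) ^ (m + 1)) ≠ 0 := by simp
    exact mul_left_cancel₀ hne h2

lemma subst_exp {a : ℝ} (ha : 0 < a) {p q : ℝ} (hpq : p ≤ q) (k : ℝ → ℝ) :
    ∫ x in (a * Real.exp p)..(a * Real.exp q), k x
      = ∫ u in p..q, a * Real.exp u * k (a * Real.exp u) := by
  have hmono : StrictMono (fun u : ℝ => a * Real.exp u) := fun x y h =>
    mul_lt_mul_of_pos_left (Real.exp_lt_exp.mpr h) ha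
  have hle : a * Real.exp p ≤ a * Real.exp q := hmono.monotone hpq
  have himg : (fun u : ℝ => a * Real.exp u) '' Set.Icc p q
      = Set.Icc (a * Real.exp p) (a * Real.exp q) := by
    apply Set.Subset.antisymm
    · rintro _ ⟨u, hu, rfl⟩
      exact ⟨hmono.monotone hu.1, hmono.monotone hu.2⟩
    · exact intermediate_value_Icc hpq (f := fun u : ℝ => a * Real.exp u) (by fun_prop)
  rw [intervalIntegral.integral_of_le hle, intervalIntegral.integral_of_le hpq,
    ← integral_Icc_eq_integral_Ioc, ← integral_Icc_eq_integral_Ioc, ← himg,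
    integral_image_eq_integral_abs_deriv_smul measurableSet_Icc
      (f' := fun u => a * Real.exp u)
      (fun x _ => ((Real.hasDerivAt_exp x).const_mul a).hasDerivWithinAt) hmono.injective.injOn]
  refine setIntegral_congr_fun measurableSet_Icc fun x _ => ?_
  have := mul_pos ha (Real.exp_pos x)
  simp only [smul_eq_mul]
  rw [abs_of_pos this]

lemma left_eq {a : ℝ} (ha : 0 < a) (α : ℝ) (n : ℕ) (f : ℝ → ℝ) {u : ℝ} (hu : 0 ≤ u) :
    hadLeftKer a α n f (a * Real.exp u)
      = RI ((n : ℝ) - α) (fun v => f (a * Real.exp v)) u := by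
  unfold hadLeftKer RI
  have h := subst_exp ha hu
    (fun t => Real.log (a * Real.exp u / t) ^ ((n : ℝ) - α - 1) * f t / t)
  rw [Real.exp_zero, mul_one] at h
  rw [h]
  congr 1
  ext v
  have hv := mul_pos ha (Real.exp_pos v)
  have : Real.log (a * Real.exp u / (a * Real.exp v)) = u - v := by
    rw [mul_div_mul_left _ _ ha.ne', ← Real.exp_sub, Real.log_exp]
  rw [this]
  field_simp

lemma right_eq {a : ℝ} (ha : 0 < a) (α : ℝ) (n : ℕ) (f : ℝ → ℝ) {u L : ℝ} (hu : u ≤ L) :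
    hadRightKer (a * Real.exp L) α n f (a * Real.exp u)
      = RJ L ((n : ℝ) - α) (fun v => f (a * Real.exp v)) u := by
  unfold hadRightKer RJ
  rw [subst_exp ha hu]
  congr 1
  ext v
  have hv := mul_pos ha (Real.exp_pos v)
  have : Real.log (a * Real.exp v / (a * Real.exp u)) = v - u := by
    rw [mul_div_mul_left _ _ ha.ne', ← Real.exp_sub, Real.log_exp]
  rw [this]
  field_simp

lemma DH_deriv {H : ℝ → ℝ} {a u : ℝ} {k : ℕ}
    (h : DifferentiableAt ℝ (DH^[k] H) (a * Real.exp u)) :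
    HasDerivAt (fun v => DH^[k] H (a * Real.exp v)) (DH^[k + 1] H (a * Real.exp u)) u := by
  have := h.hasDerivAt.comp u ((Real.hasDerivAt_exp u).const_mul a)
  rw [Function.iterate_succ_apply']
  unfold DH
  rw [mul_comm]
  exact this

theorem main {a L : ℝ} (ha : 0 < a) (hL : 0 < L)
    (n : ℕ) (hn : 0 < n) (α : ℝ) (hα : α ∈ Set.Ioo ((n : ℝ) - 1) (n : ℝ))
    (f g : ℝ → ℝ) (hf : ContinuousOn f (Set.Icc a (a * Real.exp L)))
    (hg : ContDiffOn ℝ n g (Set.Icc a (a * Real.exp L)))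
    (hga : g a = 0) (hgb : g (a * Real.exp L) = 0)
    (hkerL : ContDHDiffOn n (hadLeftKer a α n f) (Set.Icc a (a * Real.exp L)))
    (hkerR : ContDHDiffOn n (hadRightKer (a * Real.exp L) α n f) (Set.Icc a (a * Real.exp L)))
    (hdiffg : ∀ x ∈ Set.Ioo a (a * Real.exp L), ∀ k < n,
      DifferentiableAt ℝ (DH^[k] (hadLeftKer a α n g)) x ∧
        DifferentiableAt ℝ (DH^[k] (hadRightKer (a * Real.exp L) α n g)) x) :
    (∫ x in a..(a * Real.exp L), x⁻¹ * f x * rieszHad a (a * Real.exp L) α n g x) =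
      (-1 : ℝ) ^ n * ∫ x in a..(a * Real.exp L),
        x⁻¹ * rieszHad a (a * Real.exp L) α n f x * g x := by
  obtain ⟨hα1, hα2⟩ := hα
  have hs : 0 < (n : ℝ) - α := by linarith
  have hs1 : (n : ℝ) - α < 1 := by linarith
  have hmono : StrictMono (fun u : ℝ => a * Real.exp u) := fun x y h =>
    mul_lt_mul_of_pos_left (Real.exp_lt_exp.mpr h) ha
  have hz : a * Real.exp 0 = a := by simp
  have hIcc : Set.MapsTo (fun u : ℝ => a * Real.exp u) (Set.Icc 0 L)
      (Set.Icc a (a * Real.exp L)) := fun u hu =>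
    ⟨hz.symm.le.trans (hmono.monotone hu.1), hmono.monotone hu.2⟩
  have hIoo : Set.MapsTo (fun u : ℝ => a * Real.exp u) (Set.Ioo 0 L)
      (Set.Ioo a (a * Real.exp L)) := fun u hu =>
    ⟨hz.symm.le.trans_lt (hmono hu.1), hmono hu.2⟩
  have hcexp : ContinuousOn (fun u : ℝ => a * Real.exp u) (Set.Icc 0 L) := by fun_prop
  have hccexp : ContDiffOn ℝ n (fun u : ℝ => a * Real.exp u) (Set.Icc 0 L) :=
    (contDiff_const.mul Real.contDiff_exp).contDiffOn
  set F : ℕ → ℝ → ℝ := fun k u => DH^[k] (hadLeftKer a α n f) (a * Real.exp u) with hFdef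
  set G : ℕ → ℝ → ℝ := fun k u => DH^[k] (hadRightKer (a * Real.exp L) α n f) (a * Real.exp u)
    with hGdef
  set P : ℕ → ℝ → ℝ := fun k u => DH^[k] (hadLeftKer a α n g) (a * Real.exp u) with hPdef
  set Q : ℕ → ℝ → ℝ := fun k u => DH^[k] (hadRightKer (a * Real.exp L) α n g) (a * Real.exp u)
    with hQdef
  set f0 : ℝ → ℝ := fun u => f (a * Real.exp u) with hf0def
  set g0 : ℝ → ℝ := fun u => g (a * Real.exp u) with hg0def
  set gg : ℕ → ℝ → ℝ := fun k => iteratedDerivWithin k g0 (Set.Icc 0 L) with hggdef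
  have hgg0 : gg 0 = g0 := by rw [hggdef]; exact iteratedDerivWithin_zero
  have hg0 : ContDiffOn ℝ n g0 (Set.Icc 0 L) := hg.comp hccexp hIcc
  have hud : UniqueDiffOn ℝ (Set.Icc (0:ℝ) L) := uniqueDiffOn_Icc hL
  have hgc : CChain n L gg := fun k hk =>
    hg0.continuousOn_iteratedDerivWithin (by exact_mod_cast hk) hud
  have hgd : DChain n L gg := by
    intro k hk x hx
    have h1 : DifferentiableWithinAt ℝ (gg k) (Set.Icc 0 L) x :=
      hg0.differentiableOn_iteratedDerivWithin (by exact_mod_cast hk) hud x ⟨hx.1.le, hx.2.le⟩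
    have h2 := h1.hasDerivWithinAt.hasDerivAt (Icc_mem_nhds hx.1 hx.2)
    have h3 : gg (k + 1) x = derivWithin (gg k) (Set.Icc 0 L) x :=
      congrFun iteratedDerivWithin_succ x
    rw [h3]
    exact h2
  have hFc : CChain n L F := fun k hk => (hkerL.1 k hk).comp hcexp hIcc
  have hGc : CChain n L G := fun k hk => (hkerR.1 k hk).comp hcexp hIcc
  have hFd : DChain n L F := fun k hk x hx =>
    DH_deriv (hkerL.2 k hk _ (hIcc ⟨hx.1.le, hx.2.le⟩))
  have hGd : DChain n L G := fun k hk x hx =>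
    DH_deriv (hkerR.2 k hk _ (hIcc ⟨hx.1.le, hx.2.le⟩))
  have hPd : DChain n L P := fun k hk x hx => DH_deriv (hdiffg _ (hIoo hx) k hk).1
  have hQd : DChain n L Q := fun k hk x hx => DH_deriv (hdiffg _ (hIoo hx) k hk).2
  have hf0 : ContinuousOn f0 (Set.Icc 0 L) := hf.comp hcexp hIcc
  have hF : Set.EqOn (RI ((n:ℝ) - α) f0) (F 0) (Set.Icc 0 L) :=
    fun u hu => (left_eq ha α n f hu.1).symm
  have hG : Set.EqOn (RJ L ((n:ℝ) - α) f0) (G 0) (Set.Icc 0 L) :=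
    fun u hu => (right_eq ha α n f hu.2).symm
  have hP : ∀ x ∈ Set.Ioo 0 L, P 0 x = RI ((n:ℝ) - α) (gg 0) x := by
    intro u hu
    rw [hgg0]
    exact left_eq ha α n g hu.1.le
  have hQ : ∀ x ∈ Set.Ioo 0 L, Q 0 x = RJ L ((n:ℝ) - α) (gg 0) x := by
    intro u hu
    rw [hgg0]
    exact right_eq ha α n g hu.2.le
  have hgz : gg 0 0 = 0 := by rw [hgg0, hg0def]; simpa using hga
  have hgL : gg 0 L = 0 := by rw [hgg0, hg0def]; exact hgb
  obtain ⟨hiQ, heQ⟩ := core_right hs hs1 hL hn hgc hgd hgz hgL hQd hQ f0 F G hf0 hFc hFd hGc hGd hF hG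
  have hleft : IntervalIntegrable (fun x => f0 x * P n x) volume 0 L ∧
      ∫ x in (0:ℝ)..L, f0 x * P n x = (-1) ^ n * ∫ x in (0:ℝ)..L, G n x * gg 0 x := by
    obtain ⟨m, hm⟩ : ∃ m, n = m + 1 := ⟨n - 1, by omega⟩
    have := (core_left hs hs1 hL hgc hgd hgz hgL hPd hP m (by omega) f0 F G hf0
      (by rwa [← hm]) (by rwa [← hm]) (by rwa [← hm]) (by rwa [← hm]) hF hG).2
    rwa [← hm] at this
  obtain ⟨hiP, heP⟩ := hleft
  rw [hgg0] at heP heQ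
  have hsq : ((-1:ℝ) ^ n) * (-1) ^ n = 1 := by rw [← mul_pow]; simp
  have hrz : ∀ (h : ℝ → ℝ) (x : ℝ), rieszHad a (a * Real.exp L) α n h x
      = (1 / 2 * (1 / Real.Gamma ((n:ℝ) - α))) *
        (DH^[n] (hadLeftKer a α n h) x + DH^[n] (hadRightKer (a * Real.exp L) α n h) x) := by
    intro h x
    unfold rieszHad hadLeft hadRight
    linear_combination (1 / 2 * (1 / Real.Gamma ((n:ℝ) - α))) *
      DH^[n] (hadRightKer (a * Real.exp L) α n h) x * hsq
  set c : ℝ := 1 / 2 * (1 / Real.Gamma ((n:ℝ) - α)) with hc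
  have hI1 : (∫ x in a..(a * Real.exp L), x⁻¹ * f x * rieszHad a (a * Real.exp L) α n g x)
      = c * ∫ u in (0:ℝ)..L, (f0 u * P n u + f0 u * Q n u) := by
    have h := subst_exp ha hL.le (fun x => x⁻¹ * f x * rieszHad a (a * Real.exp L) α n g x)
    rw [hz] at h
    rw [h, ← intervalIntegral.integral_const_mul]
    congr 1
    ext u
    have hv := mul_pos ha (Real.exp_pos u)
    rw [hrz]
    simp only [hf0def, hPdef, hQdef]
    rw [show ∀ y p q r : ℝ, y * (y⁻¹ * p * (c * (q + r))) = (y * y⁻¹) * (c * (p * q + p * r)) by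
      intros; ring, mul_inv_cancel₀ hv.ne', one_mul]
  have hI2 : (∫ x in a..(a * Real.exp L), x⁻¹ * rieszHad a (a * Real.exp L) α n f x * g x)
      = c * ∫ u in (0:ℝ)..L, (F n u * g0 u + G n u * g0 u) := by
    have h := subst_exp ha hL.le (fun x => x⁻¹ * rieszHad a (a * Real.exp L) α n f x * g x)
    rw [hz] at h
    rw [h, ← intervalIntegral.integral_const_mul]
    congr 1
    ext u
    have hv := mul_pos ha (Real.exp_pos u)
    rw [hrz]
    simp only [hg0def, hFdef, hGdef]
    rw [show ∀ y p q r : ℝ, y * (y⁻¹ * (c * (q + r)) * p) = (y * y⁻¹) * (c * (q * p + r * p)) by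
      intros; ring, mul_inv_cancel₀ hv.ne', one_mul]
  have hiF : IntervalIntegrable (fun u => F n u * g0 u) volume 0 L :=
    ((hFc n le_rfl).mul hg0.continuousOn).intervalIntegrable_of_Icc hL.le
  have hiG : IntervalIntegrable (fun u => G n u * g0 u) volume 0 L :=
    ((hGc n le_rfl).mul hg0.continuousOn).intervalIntegrable_of_Icc hL.le
  rw [hI1, hI2, intervalIntegral.integral_add hiP hiQ, intervalIntegral.integral_add hiF hiG,
    heP, heQ]
  ring

end RH

/-- Riesz fractional integration by parts with vanishing boundary terms. -/
theorem statement_10 (a b : ℝ) (ha : 0 < a) (hab : a < b)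
    (n : ℕ) (hn : 0 < n) (α : ℝ) (hα : α ∈ Set.Ioo ((n : ℝ) - 1) (n : ℝ))
    (f g : ℝ → ℝ) (hf : ContinuousOn f (Set.Icc a b))
    (hg : ContDiffOn ℝ n g (Set.Icc a b))
    (hvana : ∀ k < n, DH^[k] g a = 0) (hvanb : ∀ k < n, DH^[k] g b = 0)
    (hkerL : ContDHDiffOn n (hadLeftKer a α n f) (Set.Icc a b))
    (hkerR : ContDHDiffOn n (hadRightKer b α n f) (Set.Icc a b))
    (hdiffg : ∀ x ∈ Set.Ioo a b, ∀ k < n,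
      DifferentiableAt ℝ (DH^[k] (hadLeftKer a α n g)) x ∧
        DifferentiableAt ℝ (DH^[k] (hadRightKer b α n g)) x) :
    (∫ x in a..b, x⁻¹ * f x * rieszHad a b α n g x) =
      (-1 : ℝ) ^ n * ∫ x in a..b, x⁻¹ * rieszHad a b α n f x * g x := by
  have hL : 0 < Real.log (b / a) := Real.log_pos ((one_lt_div ha).mpr hab)
  have hb : b = a * Real.exp (Real.log (b / a)) := by
    rw [Real.exp_log (div_pos (ha.trans hab) ha)]
    field_simp
  generalize Real.log (b / a) = L at hL hb
  subst hb
  exact RH.main ha hL n hn α hα f g hf hg (hvana 0 hn) (hvanb 0 hn) hkerL hkerR hdiffg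
end

section
/- Let 0 < a < b, let β ∈ (0,1), and let f, h : [a,b] → ℝ be continuous. Then the order of integration in the following logarithmic-kernel double integral can be exchanged (Dirichlet's formula): ∫_a^b x⁻¹ f(x) · ( ∫_a^x (ln(x/t))^{β−1} h(t) t⁻¹ dt ) dx = ∫_a^b t⁻¹ h(t) · ( ∫_t^b (ln(x/t))^{β−1} f(x) x⁻¹ dx ) dt; in particular both iterated integrals are well defined and finite. -/
open MeasureTheory

lemma aux_bound {b β x t : ℝ} (hβ : β ∈ Set.Ioo (0 : ℝ) 1) (ht : 0 < t) (htx : t ≤ x)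
    (hxb : x ≤ b) :
    ‖Real.log (x / t) ^ (β - 1)‖ ≤ b ^ (1 - β) * (x - t) ^ (β - 1) := by
  have hb : 0 < b := by linarith
  have hx : 0 < x := by linarith
  have hne : β - 1 ≠ 0 := by linarith [hβ.2]
  rcases htx.eq_or_lt with rfl | hlt
  · simp [div_self ht.ne', Real.zero_rpow hne]
  have h1 : (x - t) / b ≤ Real.log (x / t) := by
    have h2 := Real.one_sub_inv_le_log_of_pos (div_pos hx ht)
    have h3 : (x - t) / b ≤ (x - t) / x :=
      div_le_div_of_nonneg_left (by linarith) hx hxb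
    have h4 : (x - t) / x = 1 - (x / t)⁻¹ := by field_simp
    linarith
  have h0 : 0 < (x - t) / b := div_pos (by linarith) hb
  rw [Real.norm_of_nonneg (Real.rpow_nonneg (h0.le.trans h1) _)]
  refine (Real.rpow_le_rpow_of_nonpos h0 h1 (by linarith [hβ.2])).trans (le_of_eq ?_)
  rw [Real.div_rpow (by linarith) hb.le, show 1 - β = -(β - 1) by ring, Real.rpow_neg hb.le]
  field_simp

lemma aux_ii {c d β y : ℝ} (hβ : β ∈ Set.Ioo (0 : ℝ) 1) :
    IntervalIntegrable (fun t => (t - y) ^ (β - 1)) volume c d := by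
  have h := (intervalIntegral.intervalIntegrable_rpow' (a := c - y) (b := d - y) (r := β - 1)
    (by linarith [hβ.1])).comp_sub_right y
  simpa using h

lemma aux_ii' {c d β y : ℝ} (hβ : β ∈ Set.Ioo (0 : ℝ) 1) :
    IntervalIntegrable (fun t => (y - t) ^ (β - 1)) volume c d := by
  have h := (intervalIntegral.intervalIntegrable_rpow' (a := y - c) (b := y - d) (r := β - 1)
    (by linarith [hβ.1])).comp_sub_left y
  simpa using h

/-- truncated kernel -/
noncomputable def auxK (β x t : ℝ) : ℝ := if t < x then Real.log (x / t) ^ (β - 1) else 0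

lemma auxK_meas (β : ℝ) : Measurable (fun p : ℝ × ℝ => auxK β p.1 p.2) := by
  unfold auxK
  refine Measurable.ite (measurableSet_lt measurable_snd measurable_fst) ?_ measurable_const
  exact (Real.measurable_log.comp (measurable_fst.div measurable_snd)).pow_const _

lemma auxK_int {a b β : ℝ} (ha : 0 < a) (hab : a < b) (hβ : β ∈ Set.Ioo (0 : ℝ) 1) :
    Integrable (fun p : ℝ × ℝ => auxK β p.1 p.2)
      ((volume.restrict (Set.Ioc a b)).prod (volume.restrict (Set.Ioc a b))) := by
  have hb : 0 < b := by linarith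
  set g : ℝ → ℝ := (Set.Ioc 0 b).indicator (fun u => u ^ (β - 1)) with hg
  have hgi : Integrable g volume := by
    rw [hg, integrable_indicator_iff measurableSet_Ioc]
    exact (intervalIntegrable_iff_integrableOn_Ioc_of_le hb.le).1
      (intervalIntegral.intervalIntegrable_rpow' (by linarith [hβ.1]))
  have hfi : Integrable ((Set.Ioc a b).indicator (fun _ => (1 : ℝ))) volume := by
    rw [integrable_indicator_iff measurableSet_Ioc]
    simp
  have hc := hfi.convolution_integrand (ContinuousLinearMap.mul ℝ ℝ) hgi
  have hc2 := (hc.restrict (s := Set.Ioc a b ×ˢ Set.Ioc a b)).const_mul (b ^ (1 - β))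
  rw [Measure.prod_restrict]
  refine hc2.mono' (auxK_meas β).aestronglyMeasurable ?_
  filter_upwards [ae_restrict_mem (measurableSet_Ioc.prod measurableSet_Ioc)] with p hp
  obtain ⟨⟨h1, h2⟩, h3, h4⟩ := hp
  have hpm : p.2 ∈ Set.Ioc a b := ⟨h3, h4⟩
  simp only [ContinuousLinearMap.mul_apply', Set.indicator_of_mem hpm, one_mul]
  unfold auxK
  split_ifs with hlt
  · rw [hg, Set.indicator_of_mem (show p.1 - p.2 ∈ Set.Ioc 0 b from ⟨by linarith, by linarith⟩)]
    exact aux_bound hβ (by linarith) hlt.le h2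
  · rw [norm_zero]
    refine mul_nonneg (Real.rpow_nonneg hb.le _) (Set.indicator_nonneg ?_ _)
    intro u hu
    exact Real.rpow_nonneg hu.1.le _

lemma aux_inner1 {a b β x : ℝ} (hβ : β ∈ Set.Ioo (0 : ℝ) 1) (ha : 0 < a)
    (h : ℝ → ℝ) (hx : x ∈ Set.Ioc a b) :
    (∫ t in a..x, Real.log (x / t) ^ (β - 1) * h t / t) =
      ∫ t in Set.Ioc a b, auxK β x t * (t⁻¹ * h t) := by
  have hne : β - 1 ≠ 0 := by linarith [hβ.2]
  rw [intervalIntegral.integral_of_le hx.1.le]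
  have : Set.Ioc a x ⊆ Set.Ioc a b := Set.Ioc_subset_Ioc_right hx.2
  rw [setIntegral_eq_of_subset_of_forall_sdiff_eq_zero measurableSet_Ioc this]
  · refine setIntegral_congr_fun measurableSet_Ioc ?_
    intro t ht
    simp only [auxK]
    split_ifs with hlt
    · ring
    · have : t = x := le_antisymm ht.2 (not_lt.1 hlt)
      subst this
      have : t ≠ 0 := by linarith [hx.1]
      simp [div_self this, Real.zero_rpow hne]
  · intro t ht
    have : ¬ t < x := fun hlt => ht.2 ⟨ht.1.1, hlt.le⟩
    simp [auxK, this]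

lemma aux_inner2 {a b β t : ℝ} (f : ℝ → ℝ) (ht : t ∈ Set.Ioc a b) :
    (∫ x in t..b, Real.log (x / t) ^ (β - 1) * f x / x) =
      ∫ x in Set.Ioc a b, auxK β x t * (x⁻¹ * f x) := by
  rw [intervalIntegral.integral_of_le ht.2]
  have : Set.Ioc t b ⊆ Set.Ioc a b := Set.Ioc_subset_Ioc_left ht.1.le
  rw [setIntegral_eq_of_subset_of_forall_sdiff_eq_zero measurableSet_Ioc this]
  · refine setIntegral_congr_fun measurableSet_Ioc ?_
    intro x hx
    simp only [auxK, if_pos hx.1]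
    ring
  · intro x hx
    have : ¬ t < x := fun hlt => hx.2 ⟨hlt, hx.1.2⟩
    simp [auxK, this]

lemma aux_F {a b β : ℝ} (ha : 0 < a) (hab : a < b) (hβ : β ∈ Set.Ioo (0 : ℝ) 1)
    (u v : ℝ → ℝ) (hu : ContinuousOn u (Set.Icc a b)) (hv : ContinuousOn v (Set.Icc a b)) :
    Integrable (fun p : ℝ × ℝ => (u p.1 * v p.2) * auxK β p.1 p.2)
      ((volume.restrict (Set.Ioc a b)).prod (volume.restrict (Set.Ioc a b))) := by
  obtain ⟨C, hC⟩ := isCompact_Icc.exists_bound_of_continuousOn hu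
  obtain ⟨D, hD⟩ := isCompact_Icc.exists_bound_of_continuousOn hv
  have hm : ∀ w : ℝ → ℝ, ContinuousOn w (Set.Icc a b) →
      AEStronglyMeasurable w (volume.restrict (Set.Ioc a b)) := fun w hw =>
    (hw.mono Set.Ioc_subset_Icc_self).aestronglyMeasurable measurableSet_Ioc
  refine (auxK_int ha hab hβ).bdd_mul (c := C * D) ((hm u hu).comp_fst.mul (hm v hv).comp_snd) ?_
  rw [Measure.prod_restrict]
  filter_upwards [ae_restrict_mem (measurableSet_Ioc.prod measurableSet_Ioc)] with p hp
  have h1 := hC _ (Set.Ioc_subset_Icc_self hp.1)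
  have h2 := hD _ (Set.Ioc_subset_Icc_self hp.2)
  rw [norm_mul]
  exact mul_le_mul h1 h2 (norm_nonneg _) ((norm_nonneg _).trans h1)

/-- Dirichlet's formula: exchange of order of integration for the logarithmic-kernel
double integral; in particular all the iterated integrals are well defined and finite. -/
theorem statement_11 (a b : ℝ) (ha : 0 < a) (hab : a < b)
    (β : ℝ) (hβ : β ∈ Set.Ioo (0 : ℝ) 1)
    (f h : ℝ → ℝ) (hf : ContinuousOn f (Set.Icc a b)) (hh : ContinuousOn h (Set.Icc a b)) :
    (∀ x ∈ Set.Icc a b,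
      IntervalIntegrable (fun t => Real.log (x / t) ^ (β - 1) * h t / t) volume a x) ∧
    (∀ t ∈ Set.Icc a b,
      IntervalIntegrable (fun x => Real.log (x / t) ^ (β - 1) * f x / x) volume t b) ∧
    IntervalIntegrable
      (fun x => x⁻¹ * f x * ∫ t in a..x, Real.log (x / t) ^ (β - 1) * h t / t) volume a b ∧
    IntervalIntegrable
      (fun t => t⁻¹ * h t * ∫ x in t..b, Real.log (x / t) ^ (β - 1) * f x / x) volume a b ∧
    (∫ x in a..b, x⁻¹ * f x * ∫ t in a..x, Real.log (x / t) ^ (β - 1) * h t / t) =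
      ∫ t in a..b, t⁻¹ * h t * ∫ x in t..b, Real.log (x / t) ^ (β - 1) * f x / x := by
  have hinv : ContinuousOn (fun x : ℝ => x⁻¹) (Set.Icc a b) :=
    continuousOn_inv₀.mono fun x hx => by
      have : x ≠ 0 := by linarith [hx.1]
      simpa using this
  have hu : ContinuousOn (fun x => x⁻¹ * f x) (Set.Icc a b) := hinv.mul hf
  have hv : ContinuousOn (fun x => x⁻¹ * h x) (Set.Icc a b) := hinv.mul hh
  have hF := aux_F ha hab hβ _ _ hu hv
  have e1 : ∀ x ∈ Set.Ioc a b,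
      (∫ t in Set.Ioc a b, ((x⁻¹ * f x) * (t⁻¹ * h t)) * auxK β x t) =
      x⁻¹ * f x * ∫ t in a..x, Real.log (x / t) ^ (β - 1) * h t / t := by
    intro x hx
    rw [aux_inner1 hβ ha h hx, ← integral_const_mul]
    congr 1; ext t; ring
  have e2 : ∀ t ∈ Set.Ioc a b,
      (∫ x in Set.Ioc a b, ((x⁻¹ * f x) * (t⁻¹ * h t)) * auxK β x t) =
      t⁻¹ * h t * ∫ x in t..b, Real.log (x / t) ^ (β - 1) * f x / x := by
    intro t ht
    rw [aux_inner2 f ht, ← integral_const_mul]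
    congr 1; ext x; ring
  refine ⟨?_, ?_, ?_, ?_, ?_⟩
  · intro x hx
    have hk : IntervalIntegrable (fun t => Real.log (x / t) ^ (β - 1)) volume a x := by
      refine ((aux_ii' (y := x) hβ).const_mul (b ^ (1 - β))).mono_fun' ?_ ?_
      · exact ((Real.measurable_log.comp (measurable_const.div measurable_id)).pow_const
          _).aestronglyMeasurable
      · rw [Set.uIoc_of_le hx.1]
        filter_upwards [ae_restrict_mem measurableSet_Ioc] with t ht
        exact aux_bound hβ (by linarith [ht.1]) ht.2 hx.2
    have := hk.mul_continuousOn (g := fun t => t⁻¹ * h t)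
      (by rw [Set.uIcc_of_le hx.1]; exact hv.mono (Set.Icc_subset_Icc_right hx.2))
    convert this using 2
    ring
  · intro t ht
    have hk : IntervalIntegrable (fun x => Real.log (x / t) ^ (β - 1)) volume t b := by
      refine ((aux_ii (y := t) hβ).const_mul (b ^ (1 - β))).mono_fun' ?_ ?_
      · exact ((Real.measurable_log.comp (measurable_id.div measurable_const)).pow_const
          _).aestronglyMeasurable
      · rw [Set.uIoc_of_le ht.2]
        filter_upwards [ae_restrict_mem measurableSet_Ioc] with x hx
        exact aux_bound hβ (by linarith [ht.1]) hx.1.le hx.2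
    have := hk.mul_continuousOn (g := fun x => x⁻¹ * f x)
      (by rw [Set.uIcc_of_le ht.2]; exact hu.mono (Set.Icc_subset_Icc_left ht.1))
    convert this using 2
    ring
  · rw [intervalIntegrable_iff_integrableOn_Ioc_of_le hab.le]
    exact IntegrableOn.congr_fun hF.integral_prod_left e1 measurableSet_Ioc
  · rw [intervalIntegrable_iff_integrableOn_Ioc_of_le hab.le]
    exact IntegrableOn.congr_fun hF.integral_prod_right e2 measurableSet_Ioc
  · rw [intervalIntegral.integral_of_le hab.le, intervalIntegral.integral_of_le hab.le,
      ← setIntegral_congr_fun measurableSet_Ioc e1, ← setIntegral_congr_fun measurableSet_Ioc e2]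
    exact integral_integral_swap hF
end

section
/- Let X be a separable Banach space with its Borel σ-algebra and μ₀ a Borel probability measure on X. Let m be a positive integer, Σ an m×m symmetric positive definite real matrix, y ∈ ℝ^m, and write ‖v‖_Σ = ‖Σ^{−1/2} v‖ (Euclidean norm). Let G : X → ℝ^m be Borel measurable such that for every ε > 0 there exists M = M(ε) ∈ ℝ with ‖G(u)‖_Σ ≤ exp(ε‖u‖_X² + M) for all u ∈ X. Let R : X → [0,∞) be Borel measurable such that for every r > 0 there is K(r) with R(u) ≤ K(r) whenever ‖u‖_X < r. Assume there exists r₀ > 0 with μ₀({u : ‖u‖_X < r₀}) > 0. Define Φ(u) = (1/2)‖G(u) − y‖_Σ². Then the normalization constant Z = ∫_X exp(−Φ(u) − R(u)) dμ₀(u) satisfies 0 < Z ≤ 1; consequently the posterior measure μ^y defined by dμ^y/dμ₀ = Z⁻¹ exp(−Φ − R) is a well-defined Borel probability measure on X. -/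
open MeasureTheory Matrix

/-- `‖v‖_Σ = ‖Σ^{-1/2} v‖` (Euclidean norm), expressed as `√(vᵀ Σ⁻¹ v)`. -/
noncomputable def sigmaNorm {m : ℕ} (S : Matrix (Fin m) (Fin m) ℝ) (v : Fin m → ℝ) : ℝ :=
  Real.sqrt (v ⬝ᵥ S⁻¹ *ᵥ v)

/-- Well-posedness of the posterior measure: the normalization constant
`Z = ∫ exp(−Φ−R) dμ₀` satisfies `0 < Z ≤ 1`, and the posterior
`dμ^y/dμ₀ = Z⁻¹ exp(−Φ−R)` is a well-defined Borel probability measure. -/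
theorem statement_15
    {X : Type*} [NormedAddCommGroup X] [NormedSpace ℝ X] [CompleteSpace X]
    [TopologicalSpace.SeparableSpace X] [MeasurableSpace X] [BorelSpace X]
    (μ₀ : Measure X) [IsProbabilityMeasure μ₀]
    (m : ℕ) (hm : 0 < m)
    (S : Matrix (Fin m) (Fin m) ℝ) (hSsymm : S.IsSymm) (hSpd : S.PosDef)
    (y : Fin m → ℝ)
    (G : X → Fin m → ℝ) (hG : Measurable G)
    (hGbound : ∀ ε > (0 : ℝ), ∃ M : ℝ, ∀ u : X,
      sigmaNorm S (G u) ≤ Real.exp (ε * ‖u‖ ^ 2 + M))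
    (R : X → ℝ) (hR : Measurable R) (hRnn : ∀ u, 0 ≤ R u)
    (hRbound : ∀ r > (0 : ℝ), ∃ K : ℝ, ∀ u : X, ‖u‖ < r → R u ≤ K)
    (r₀ : ℝ) (hr₀ : 0 < r₀) (hball : 0 < μ₀ {u : X | ‖u‖ < r₀})
    (Φ : X → ℝ) (hΦ : ∀ u, Φ u = (1 / 2) * sigmaNorm S (G u - y) ^ 2)
    (Z : ℝ) (hZ : Z = ∫ u, Real.exp (-Φ u - R u) ∂μ₀) :
    0 < Z ∧ Z ≤ 1 ∧
      IsProbabilityMeasure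
        (μ₀.withDensity fun u => ENNReal.ofReal (Z⁻¹ * Real.exp (-Φ u - R u))) := by
  have hcont : Continuous (sigmaNorm S) := by
    unfold sigmaNorm
    fun_prop
  have hΦm : Measurable Φ := by
    have h : Φ = fun u => (1 / 2) * sigmaNorm S (G u - y) ^ 2 := funext hΦ
    rw [h]
    exact ((hcont.measurable.comp (hG.sub_const y)).pow_const 2).const_mul _
  have hle : ∀ u, Real.exp (-Φ u - R u) ≤ 1 := by
    intro u
    rw [Real.exp_le_one_iff, hΦ u]
    have h1 := hRnn u
    have h2 := sq_nonneg (sigmaNorm S (G u - y))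
    linarith
  have hmeas : Measurable fun u => Real.exp (-Φ u - R u) := (hΦm.neg.sub hR).exp
  have hint : Integrable (fun u => Real.exp (-Φ u - R u)) μ₀ := by
    refine Integrable.of_bound hmeas.aestronglyMeasurable 1 (Filter.Eventually.of_forall fun u => ?_)
    rw [Real.norm_eq_abs, abs_of_pos (Real.exp_pos _)]
    exact hle u
  have hpos : 0 < Z := by
    rw [hZ]
    exact integral_exp_pos hint
  refine ⟨hpos, ?_, ⟨?_⟩⟩
  · rw [hZ]
    calc ∫ u, Real.exp (-Φ u - R u) ∂μ₀ ≤ ∫ _u, (1 : ℝ) ∂μ₀ :=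
          integral_mono hint (integrable_const _) hle
      _ = 1 := by simp
  · rw [withDensity_apply _ MeasurableSet.univ, Measure.restrict_univ,
      ← ofReal_integral_eq_lintegral_ofReal (hint.const_mul _)
        (Filter.Eventually.of_forall fun u =>
          mul_nonneg (inv_nonneg.2 hpos.le) (Real.exp_pos _).le),
      integral_const_mul, ← hZ, inv_mul_cancel₀ hpos.ne', ENNReal.ofReal_one]
end

section
/- Let X be a separable Banach space with Borel probability measure μ₀, m a positive integer, Σ an m×m symmetric positive definite matrix with ‖v‖_Σ = ‖Σ^{−1/2} v‖, and G : X → ℝ^m Borel measurable such that for every ε > 0 there exists M(ε) with ‖G(u)‖_Σ ≤ exp(ε‖u‖_X² + M(ε)) for all u. Let R : X → [0,∞) be Borel measurable, bounded on bounded sets. Assume μ₀({u : ‖u‖_X < r₀}) > 0 for some r₀ > 0 and the Fernique-type integrability ∫_X exp(ε‖u‖_X²) dμ₀(u) < ∞ for every ε > 0. For y ∈ ℝ^m set Φ(u; y) = (1/2)‖G(u) − y‖_Σ² and let μ^y have density dμ^y/dμ₀ = Z(y)⁻¹ exp(−Φ(·; y) − R). Then for every r > 0 there exists C = C(r) > 0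 such that for all y, y' ∈ ℝ^m with ‖y‖_Σ ≤ r and ‖y'‖_Σ ≤ r, the Hellinger distance satisfies d_Hell(μ^y, μ^{y'}) ≤ C ‖y − y'‖_Σ. -/
open MeasureTheory Matrix

open scoped MatrixOrder in
theorem sigmaNorm_eq_norm {m : ℕ} (S : Matrix (Fin m) (Fin m) ℝ) (hS : S.PosDef) :
    ∃ B : Matrix (Fin m) (Fin m) ℝ, ∀ v, sigmaNorm S v = ‖WithLp.toLp 2 (B *ᵥ v)‖ := by
  obtain ⟨B, hB⟩ := CStarAlgebra.nonneg_iff_eq_star_mul_self.1 hS.inv.posSemidef.nonneg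
  rw [Matrix.star_eq_conjTranspose] at hB
  refine ⟨B, fun v => ?_⟩
  rw [sigmaNorm, hB, EuclideanSpace.norm_eq]
  congr 1
  rw [← Matrix.mulVec_mulVec, Matrix.dotProduct_mulVec, Matrix.conjTranspose_eq_transpose_of_trivial,
    Matrix.vecMul_transpose]
  simp [dotProduct, sq]

theorem sigmaNorm_rev {m : ℕ} (S : Matrix (Fin m) (Fin m) ℝ) (hS : S.PosDef) (v w : Fin m → ℝ) :
    |sigmaNorm S v - sigmaNorm S w| ≤ sigmaNorm S (v - w) := by
  obtain ⟨B, hB⟩ := sigmaNorm_eq_norm S hS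
  rw [hB, hB, hB, Matrix.mulVec_sub, WithLp.toLp_sub]
  exact abs_norm_sub_norm_le _ _

theorem sigmaNorm_sub_le {m : ℕ} (S : Matrix (Fin m) (Fin m) ℝ) (hS : S.PosDef) (v w : Fin m → ℝ) :
    sigmaNorm S (v - w) ≤ sigmaNorm S v + sigmaNorm S w := by
  obtain ⟨B, hB⟩ := sigmaNorm_eq_norm S hS
  rw [hB, hB, hB, Matrix.mulVec_sub, WithLp.toLp_sub]
  exact norm_sub_le _ _

theorem continuous_sigmaNorm {m : ℕ} (S : Matrix (Fin m) (Fin m) ℝ) :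
    Continuous (sigmaNorm S) := by
  unfold sigmaNorm
  fun_prop

theorem gauss_lip (a b : ℝ) :
    |Real.exp (-(a ^ 2 / 4)) - Real.exp (-(b ^ 2 / 4))| ≤ |a - b| := by
  have hd : ∀ t : ℝ, HasDerivAt (fun t : ℝ => Real.exp (-(t ^ 2 / 4)))
      (Real.exp (-(t ^ 2 / 4)) * (-(t / 2))) t := by
    intro t
    have h := (((hasDerivAt_pow 2 t).div_const 4).neg).exp
    refine h.congr_deriv ?_
    simp only [Pi.neg_apply]
    push_cast
    ring
  have h := Convex.norm_image_sub_le_of_norm_hasDerivWithin_le (C := 1) (s := Set.univ)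
    (fun t _ => (hd t).hasDerivWithinAt) (fun t _ => ?_) convex_univ
    (Set.mem_univ b) (Set.mem_univ a)
  · simpa [Real.norm_eq_abs] using h
  · rw [Real.norm_eq_abs, abs_mul, abs_of_pos (Real.exp_pos _), Real.exp_neg,
      inv_mul_le_iff₀ (Real.exp_pos _)]
    have h1 := Real.add_one_le_exp (t ^ 2 / 4)
    have h2 : |-(t / 2)| ≤ t ^ 2 / 4 + 1 := by
      rw [abs_le]
      constructor <;> nlinarith [sq_nonneg (t - 1), sq_nonneg (t + 1)]
    linarith

theorem quot_bound {f f' z z' s d : ℝ} (hs : 0 < s) (hz : s ≤ z) (hz' : s ≤ z')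
    (hf0 : 0 ≤ f') (hf1 : f' ≤ 1) (hff : |f - f'| ≤ d) (hZ : |z ^ 2 - z' ^ 2| ≤ 2 * d) :
    |f / z - f' / z'| ≤ (1 / s + 1 / s ^ 3) * d := by
  have hzp : 0 < z := by linarith
  have hzp' : 0 < z' := by linarith
  have hd : 0 ≤ d := (abs_nonneg _).trans hff
  have hzz : |z' - z| ≤ d / s := by
    rw [le_div_iff₀ hs]
    have : |z ^ 2 - z' ^ 2| = |z' - z| * (z + z') := by
      rw [sq_sub_sq, abs_mul, abs_of_pos (by linarith : 0 < z + z'), abs_sub_comm z', mul_comm]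
    nlinarith [abs_nonneg (z' - z)]
  have e : f / z - f' / z' = (f - f') / z + f' * ((z' - z) / (z * z')) := by
    field_simp
    ring
  rw [e]
  have h1 : |(f - f') / z| ≤ d / s := by
    rw [abs_div, abs_of_pos hzp]
    gcongr
  have h2 : |f' * ((z' - z) / (z * z'))| ≤ 1 * ((d / s) / (s * s)) := by
    rw [abs_mul, abs_div, abs_of_nonneg hf0, abs_of_pos (mul_pos hzp hzp')]
    gcongr
  calc _ ≤ _ := abs_add_le _ _
    _ ≤ _ := add_le_add h1 h2
    _ = _ := by field_simp

/-- Lipschitz continuity of the posterior measure in the data `y` with respect to the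
Hellinger metric: for all `y, y'` in a `‖·‖_Σ`-ball of radius `r`,
`d_Hell(μ^y, μ^{y'}) ≤ C(r) ‖y − y'‖_Σ`. -/
theorem statement_16
    {X : Type*} [NormedAddCommGroup X] [NormedSpace ℝ X] [CompleteSpace X]
    [TopologicalSpace.SeparableSpace X] [MeasurableSpace X] [BorelSpace X]
    (μ₀ : Measure X) [IsProbabilityMeasure μ₀]
    (m : ℕ) (hm : 0 < m)
    (S : Matrix (Fin m) (Fin m) ℝ) (hSsymm : S.IsSymm) (hSpd : S.PosDef)
    (G : X → Fin m → ℝ) (hG : Measurable G)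
    (hGbound : ∀ ε > (0 : ℝ), ∃ M : ℝ, ∀ u : X,
      sigmaNorm S (G u) ≤ Real.exp (ε * ‖u‖ ^ 2 + M))
    (R : X → ℝ) (hR : Measurable R) (hRnn : ∀ u, 0 ≤ R u)
    (hRbound : ∀ r > (0 : ℝ), ∃ K : ℝ, ∀ u : X, ‖u‖ ≤ r → R u ≤ K)
    (r₀ : ℝ) (hr₀ : 0 < r₀) (hball : 0 < μ₀ {u : X | ‖u‖ < r₀})
    (hFernique : ∀ ε > (0 : ℝ), Integrable (fun u => Real.exp (ε * ‖u‖ ^ 2)) μ₀)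
    (Φ : X → (Fin m → ℝ) → ℝ)
    (hΦ : ∀ u y, Φ u y = (1 / 2) * sigmaNorm S (G u - y) ^ 2)
    (Z : (Fin m → ℝ) → ℝ)
    (hZ : ∀ y, Z y = ∫ u, Real.exp (-Φ u y - R u) ∂μ₀) :
    ∀ r > (0 : ℝ), ∃ C > (0 : ℝ), ∀ y y' : Fin m → ℝ,
      sigmaNorm S y ≤ r → sigmaNorm S y' ≤ r →
      Real.sqrt ((1 / 2) * ∫ u,
          (Real.sqrt ((Z y)⁻¹ * Real.exp (-Φ u y - R u)) -
            Real.sqrt ((Z y')⁻¹ * Real.exp (-Φ u y' - R u))) ^ 2 ∂μ₀) ≤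
        C * sigmaNorm S (y - y') := by
  intro r hr
  have hSn : ∀ v, 0 ≤ sigmaNorm S v := fun v => Real.sqrt_nonneg _
  obtain ⟨M, hM⟩ := hGbound 1 one_pos
  obtain ⟨K, hK⟩ := hRbound r₀ hr₀
  set B := Real.exp (r₀ ^ 2 + M) with hB
  set c := μ₀.real {u : X | ‖u‖ < r₀} * Real.exp (-((1 / 2) * (B + r) ^ 2) - K) with hc
  have hcpos : 0 < c := mul_pos (ENNReal.toReal_pos hball.ne' (measure_ne_top _ _)) (Real.exp_pos _)
  have hmeas : ∀ y, Measurable (fun u => Real.exp (-Φ u y - R u)) := by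
    intro y
    simp only [hΦ]
    have : Measurable fun u => sigmaNorm S (G u - y) :=
      (continuous_sigmaNorm S).measurable.comp (hG.sub_const y)
    fun_prop
  have hΦ0 : ∀ u y, 0 ≤ Φ u y := by
    intro u y
    rw [hΦ]
    positivity
  have hle1 : ∀ u y, Real.exp (-Φ u y - R u) ≤ 1 := by
    intro u y
    rw [Real.exp_le_one_iff]
    linarith [hΦ0 u y, hRnn u]
  have hint : ∀ y, Integrable (fun u => Real.exp (-Φ u y - R u)) μ₀ := by
    intro y
    refine Integrable.of_bound (hmeas y).aestronglyMeasurable 1 (ae_of_all _ fun u => ?_)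
    rw [Real.norm_eq_abs, abs_of_pos (Real.exp_pos _)]
    exact hle1 u y
  have hZc : ∀ y, sigmaNorm S y ≤ r → c ≤ Z y := by
    intro y hy
    have hms : MeasurableSet {u : X | ‖u‖ < r₀} := measurableSet_lt measurable_norm measurable_const
    rw [hZ]
    calc c = ∫ u in {u : X | ‖u‖ < r₀}, Real.exp (-((1 / 2) * (B + r) ^ 2) - K) ∂μ₀ := by
          rw [setIntegral_const, smul_eq_mul]
      _ ≤ ∫ u in {u : X | ‖u‖ < r₀}, Real.exp (-Φ u y - R u) ∂μ₀ := by
          refine setIntegral_mono_on (integrable_const _).integrableOn (hint y).integrableOn hms ?_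
          intro u hu
          have hu' : ‖u‖ < r₀ := hu
          apply Real.exp_le_exp.2
          have h1 := hK u hu'.le
          have h2 : sigmaNorm S (G u) ≤ B := by
            refine (hM u).trans (Real.exp_le_exp.2 ?_)
            have : ‖u‖ ^ 2 ≤ r₀ ^ 2 := by gcongr
            linarith
          have h3 : sigmaNorm S (G u - y) ≤ B + r :=
            (sigmaNorm_sub_le S hSpd _ _).trans (add_le_add h2 hy)
          have h4 : sigmaNorm S (G u - y) ^ 2 ≤ (B + r) ^ 2 := by
            have := hSn (G u - y)
            gcongr
          rw [hΦ]
          linarith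
      _ ≤ _ := setIntegral_le_integral (hint y) (ae_of_all _ fun u => (Real.exp_pos _).le)
  have hf1 : ∀ u y, Real.exp ((-Φ u y - R u) / 2) ≤ 1 := by
    intro u y
    rw [Real.exp_le_one_iff]
    linarith [hΦ0 u y, hRnn u]
  have hff : ∀ u y y', |Real.exp ((-Φ u y - R u) / 2) - Real.exp ((-Φ u y' - R u) / 2)| ≤
      sigmaNorm S (y - y') := by
    intro u y y'
    have e : ∀ y, Real.exp ((-Φ u y - R u) / 2) =
        Real.exp (-(R u / 2)) * Real.exp (-(sigmaNorm S (G u - y) ^ 2 / 4)) := by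
      intro y
      rw [← Real.exp_add, hΦ]
      ring_nf
    rw [e, e, ← mul_sub, abs_mul, abs_of_pos (Real.exp_pos _)]
    have h1 : Real.exp (-(R u / 2)) ≤ 1 := by
      rw [Real.exp_le_one_iff]
      linarith [hRnn u]
    have h2 := (gauss_lip (sigmaNorm S (G u - y')) (sigmaNorm S (G u - y))).trans
      (sigmaNorm_rev S hSpd _ _)
    rw [sub_sub_sub_cancel_left, abs_sub_comm] at h2
    calc _ ≤ 1 * _ := mul_le_mul_of_nonneg_right h1 (abs_nonneg _)
      _ ≤ _ := by rwa [one_mul]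
  have hZZ : ∀ y y', |Z y - Z y'| ≤ 2 * sigmaNorm S (y - y') := by
    intro y y'
    rw [hZ, hZ, ← integral_sub (hint y) (hint y'), ← Real.norm_eq_abs]
    refine (norm_integral_le_of_norm_le_const (C := 2 * sigmaNorm S (y - y'))
      (ae_of_all _ fun u => ?_)).trans (by simp)
    have e : ∀ y, Real.exp (-Φ u y - R u) = Real.exp ((-Φ u y - R u) / 2) ^ 2 := by
      intro y
      rw [← Real.exp_nat_mul]
      push_cast
      ring_nf
    rw [e, e, sq_sub_sq, Real.norm_eq_abs, abs_mul]
    refine mul_le_mul ?_ (hff u y y') (abs_nonneg _) (by norm_num)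
    rw [abs_of_pos (add_pos (Real.exp_pos _) (Real.exp_pos _))]
    linarith [hf1 u y, hf1 u y']
  set s := Real.sqrt c with hs
  have hspos : 0 < s := Real.sqrt_pos.2 hcpos
  refine ⟨1 / s + 1 / s ^ 3, by positivity, fun y y' hy hy' => ?_⟩
  have hd := hSn (y - y')
  have hzy := hZc y hy
  have hzy' := hZc y' hy'
  have key : ∀ u, (Real.sqrt ((Z y)⁻¹ * Real.exp (-Φ u y - R u)) -
      Real.sqrt ((Z y')⁻¹ * Real.exp (-Φ u y' - R u))) ^ 2 ≤
      ((1 / s + 1 / s ^ 3) * sigmaNorm S (y - y')) ^ 2 := by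
    intro u
    have e : ∀ y, c ≤ Z y → Real.sqrt ((Z y)⁻¹ * Real.exp (-Φ u y - R u)) =
        Real.exp ((-Φ u y - R u) / 2) / Real.sqrt (Z y) := by
      intro y h
      rw [Real.sqrt_mul (inv_nonneg.2 (hcpos.le.trans h)), Real.sqrt_inv, Real.exp_half]
      ring
    rw [e y hzy, e y' hzy']
    refine sq_le_sq' (abs_le.1 ?_).1 (abs_le.1 ?_).2 <;>
    · refine quot_bound hspos (Real.sqrt_le_sqrt hzy) (Real.sqrt_le_sqrt hzy')
        (Real.exp_pos _).le (hf1 u y') (hff u y y') ?_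
      rw [Real.sq_sqrt (hcpos.le.trans hzy), Real.sq_sqrt (hcpos.le.trans hzy')]
      exact hZZ y y'
  rw [Real.sqrt_le_left (by positivity)]
  have hI := integral_mono_of_nonneg (μ := μ₀) (ae_of_all _ fun u => sq_nonneg _)
    (integrable_const _) (ae_of_all _ key)
  rw [integral_const, probReal_univ, one_smul] at hI
  have := sq_nonneg ((1 / s + 1 / s ^ 3) * sigmaNorm S (y - y'))
  linarith
end

section
/- Let X be a separable Banach space with Borel probability measure μ₀. Let Φ, R : X → [0,∞) and, for all positive integers N₁, N₂, let Φ_{N₁}, R_{N₂} : X → [0,∞) be Borel measurable. Assume: (a) there exist r > 0 and K > 0 with μ₀({u : ‖u‖_X < r}) > 0 and Φ(u) ≤ K, R(u) ≤ K, Φ_{N₁}(u) ≤ K, R_{N₂}(u) ≤ K for all u with ‖u‖_X < r and all N₁, N₂ (constants uniform in N₁, N₂); (b) for every ε > 0 there exist sequences a_{N₁}(ε) > 0 and b_{N₂}(ε) > 0 converging to zero such that the set X_ε = {u ∈ X : |Φ(u) − Φ_{N₁}(u)| ≤ a_{N₁}(ε) and |R(u) − R_{N₂}(u)| ≤ b_{N₂}(ε)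 for all N₁, N₂} satisfies μ₀(X_ε) ≥ 1 − ε. Let μ have density proportional to exp(−Φ − R) with respect to μ₀ and μ_{N₁,N₂} density proportional to exp(−Φ_{N₁} − R_{N₂}). Then d_Hell(μ, μ_{N₁,N₂}) → 0 as N₁, N₂ → ∞. -/
open MeasureTheory

/-- Finite-dimensional approximation of the posterior measure: under uniform bounds and a
uniform approximation condition, the Hellinger distance between the posterior `μ`
(density ∝ exp(−Φ−R)) and its approximation `μ_{N₁,N₂}` (density ∝ exp(−Φ_{N₁}−R_{N₂}))
tends to zero as `N₁, N₂ → ∞`. -/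
theorem statement_17
    {X : Type*} [NormedAddCommGroup X] [NormedSpace ℝ X] [CompleteSpace X]
    [TopologicalSpace.SeparableSpace X] [MeasurableSpace X] [BorelSpace X]
    (μ₀ : Measure X) [IsProbabilityMeasure μ₀]
    (Φ R : X → ℝ) (Φs Rs : ℕ → X → ℝ)
    (hΦm : Measurable Φ) (hRm : Measurable R)
    (hΦsm : ∀ N₁, Measurable (Φs N₁)) (hRsm : ∀ N₂, Measurable (Rs N₂))
    (hΦnn : ∀ u, 0 ≤ Φ u) (hRnn : ∀ u, 0 ≤ R u)
    (hΦsnn : ∀ N₁ u, 0 ≤ Φs N₁ u) (hRsnn : ∀ N₂ u, 0 ≤ Rs N₂ u)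
    (hbound : ∃ r > (0 : ℝ), ∃ K > (0 : ℝ), 0 < μ₀ {u : X | ‖u‖ < r} ∧
      ∀ u : X, ‖u‖ < r →
        Φ u ≤ K ∧ R u ≤ K ∧ (∀ N₁, Φs N₁ u ≤ K) ∧ ∀ N₂, Rs N₂ u ≤ K)
    (happrox : ∀ ε > (0 : ℝ), ∃ aa bb : ℕ → ℝ,
      (∀ N₁, 0 < aa N₁) ∧ (∀ N₂, 0 < bb N₂) ∧
      Filter.Tendsto aa Filter.atTop (nhds 0) ∧
      Filter.Tendsto bb Filter.atTop (nhds 0) ∧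
      (1 : ENNReal) - ENNReal.ofReal ε ≤
        μ₀ {u : X | ∀ N₁ N₂, |Φ u - Φs N₁ u| ≤ aa N₁ ∧ |R u - Rs N₂ u| ≤ bb N₂}) :
    Filter.Tendsto
      (fun p : ℕ × ℕ =>
        Real.sqrt ((1 / 2) * ∫ u,
          (Real.sqrt ((∫ v, Real.exp (-Φ v - R v) ∂μ₀)⁻¹ * Real.exp (-Φ u - R u)) -
            Real.sqrt ((∫ v, Real.exp (-Φs p.1 v - Rs p.2 v) ∂μ₀)⁻¹ *
              Real.exp (-Φs p.1 u - Rs p.2 u))) ^ 2 ∂μ₀))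
      Filter.atTop (nhds 0) := by
  have hae : ∀ᵐ u ∂μ₀, Filter.Tendsto (fun N => Φs N u) Filter.atTop (nhds (Φ u)) ∧
      Filter.Tendsto (fun N => Rs N u) Filter.atTop (nhds (R u)) := by
    rw [ae_iff]
    refine le_antisymm (ENNReal.le_of_forall_pos_le_add fun ε hε _ => ?_) zero_le
    obtain ⟨aa, bb, -, -, ha, hb, hm⟩ := happrox ε (by exact_mod_cast hε)
    rw [zero_add]
    set A : Set X := {u : X | ∀ N₁ N₂, |Φ u - Φs N₁ u| ≤ aa N₁ ∧ |R u - Rs N₂ u| ≤ bb N₂}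
      with hA
    have hAm : MeasurableSet A := by
      have hAe : A = ⋂ N₁, ⋂ N₂, ({u | |Φ u - Φs N₁ u| ≤ aa N₁} ∩ {u | |R u - Rs N₂ u| ≤ bb N₂}) := by
        ext u
        simp [hA]
      rw [hAe]
      refine MeasurableSet.iInter fun N₁ => MeasurableSet.iInter fun N₂ => ?_
      have h1 : Measurable fun u => |Φ u - Φs N₁ u| := (hΦm.sub (hΦsm N₁)).abs
      have h2 : Measurable fun u => |R u - Rs N₂ u| := (hRm.sub (hRsm N₂)).abs
      exact (measurableSet_le h1 measurable_const).inter (measurableSet_le h2 measurable_const)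
    have hc : μ₀ Aᶜ ≤ ε := by
      rw [prob_compl_eq_one_sub hAm]
      calc 1 - μ₀ A ≤ 1 - (1 - ENNReal.ofReal ε) := tsub_le_tsub_left hm _
        _ ≤ ENNReal.ofReal ε := tsub_tsub_le
        _ = ε := ENNReal.ofReal_coe_nnreal
    refine le_trans (measure_mono ?_) hc
    intro u hu huA
    apply hu
    have key : ∀ (f : ℕ → ℝ) (c : ℝ) (d : ℕ → ℝ), (∀ N, |c - f N| ≤ d N) →
        Filter.Tendsto d Filter.atTop (nhds 0) → Filter.Tendsto f Filter.atTop (nhds c) := by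
      intro f c d h hd
      rw [tendsto_iff_dist_tendsto_zero]
      refine squeeze_zero (fun _ => dist_nonneg) (fun N => ?_) hd
      rw [dist_comm, Real.dist_eq]
      exact h N
    exact ⟨key _ _ aa (fun N => (huA N 0).1) ha, key _ _ bb (fun N => (huA 0 N).2) hb⟩
  have haep : ∀ᵐ u ∂μ₀, Filter.Tendsto (fun p : ℕ × ℕ => Real.exp (-Φs p.1 u - Rs p.2 u))
      Filter.atTop (nhds (Real.exp (-Φ u - R u))) := by
    filter_upwards [hae] with u hu
    rw [← Filter.prod_atTop_atTop_eq]
    exact (Real.continuous_exp.tendsto _).comp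
      ((hu.1.comp Filter.tendsto_fst).neg.sub (hu.2.comp Filter.tendsto_snd))
  have hle : ∀ a b : ℝ, 0 ≤ a → 0 ≤ b → Real.exp (-a - b) ≤ 1 := by
    intro a b ha hb
    rw [Real.exp_le_one_iff]
    linarith
  have hmeas : ∀ p : ℕ × ℕ, Measurable fun u => Real.exp (-Φs p.1 u - Rs p.2 u) :=
    fun p => Real.measurable_exp.comp ((hΦsm _).neg.sub (hRsm _))
  have hmeas0 : Measurable fun u => Real.exp (-Φ u - R u) :=
    Real.measurable_exp.comp (hΦm.neg.sub hRm)
  have hZt : Filter.Tendsto (fun p : ℕ × ℕ => ∫ v, Real.exp (-Φs p.1 v - Rs p.2 v) ∂μ₀)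
      Filter.atTop (nhds (∫ v, Real.exp (-Φ v - R v) ∂μ₀)) := by
    refine tendsto_integral_filter_of_dominated_convergence (fun _ => (1 : ℝ)) ?_ ?_
      (integrable_const _) haep
    · exact Filter.Eventually.of_forall fun p => (hmeas p).aestronglyMeasurable
    · refine Filter.Eventually.of_forall fun p => Filter.Eventually.of_forall fun u => ?_
      rw [Real.norm_eq_abs, abs_of_pos (Real.exp_pos _)]
      exact hle _ _ (hΦsnn _ _) (hRsnn _ _)
  have hZ : 0 < ∫ v, Real.exp (-Φ v - R v) ∂μ₀ := by
    apply integral_exp_pos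
    refine Integrable.of_bound hmeas0.aestronglyMeasurable 1 ?_
    refine Filter.Eventually.of_forall fun u => ?_
    rw [Real.norm_eq_abs, abs_of_pos (Real.exp_pos _)]
    exact hle _ _ (hΦnn _) (hRnn _)
  set Z := ∫ v, Real.exp (-Φ v - R v) ∂μ₀
  set Zp : ℕ × ℕ → ℝ := fun p => ∫ v, Real.exp (-Φs p.1 v - Rs p.2 v) ∂μ₀
  have hZi : Filter.Tendsto (fun p => (Zp p)⁻¹) Filter.atTop (nhds Z⁻¹) := hZt.inv₀ hZ.ne'
  have hint : Filter.Tendsto (fun p : ℕ × ℕ => ∫ u, (Real.sqrt (Z⁻¹ * Real.exp (-Φ u - R u)) -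
      Real.sqrt ((Zp p)⁻¹ * Real.exp (-Φs p.1 u - Rs p.2 u))) ^ 2 ∂μ₀)
      Filter.atTop (nhds (∫ _u, (0 : ℝ) ∂μ₀)) := by
    refine tendsto_integral_filter_of_dominated_convergence (fun _ => Z⁻¹ + (Z⁻¹ + 1)) ?_ ?_
      (integrable_const _) ?_
    · refine Filter.Eventually.of_forall fun p => Measurable.aestronglyMeasurable ?_
      exact ((hmeas0.const_mul _).sqrt.sub ((hmeas p).const_mul _).sqrt).pow_const 2
    · filter_upwards [hZi.eventually (gt_mem_nhds (lt_add_one Z⁻¹)),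
        hZt.eventually (lt_mem_nhds hZ)] with p hp hp0
      refine Filter.Eventually.of_forall fun u => ?_
      have hp0' : 0 < (Zp p)⁻¹ := inv_pos.2 hp0
      have hZ' : 0 < Z⁻¹ := inv_pos.2 hZ
      have e1 := hle _ _ (hΦnn u) (hRnn u)
      have e2 := hle _ _ (hΦsnn p.1 u) (hRsnn p.2 u)
      have a1 : 0 ≤ Z⁻¹ * Real.exp (-Φ u - R u) := by positivity
      have a2 : 0 ≤ (Zp p)⁻¹ * Real.exp (-Φs p.1 u - Rs p.2 u) := by positivity
      have b1 := mul_le_of_le_one_right hZ'.le e1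
      have b2 := mul_le_of_le_one_right hp0'.le e2
      rw [Real.norm_eq_abs, abs_of_nonneg (sq_nonneg _)]
      have s1 := Real.sq_sqrt a1
      have s2 := Real.sq_sqrt a2
      have m := mul_nonneg (Real.sqrt_nonneg (Z⁻¹ * Real.exp (-Φ u - R u)))
        (Real.sqrt_nonneg ((Zp p)⁻¹ * Real.exp (-Φs p.1 u - Rs p.2 u)))
      rw [sub_sq, s1, s2]
      linarith
    · filter_upwards [haep] with u hu
      have h := ((tendsto_const_nhds (x := Real.sqrt (Z⁻¹ * Real.exp (-Φ u - R u)))).sub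
        (hZi.mul hu).sqrt).pow 2
      simpa using h
  have h := (hint.const_mul (1 / 2)).sqrt
  simpa using h
end

section
/- Let X be a separable Hilbert space with orthonormal basis (e_k)_{k≥1} and let μ₀ be a Borel probability measure on X with ∫_X ‖u‖² dμ₀(u) < ∞ and μ₀({u : ‖u‖ ≤ r}) > 0 for every r > 0. Let Φ, R : X → [0,∞) be Borel measurable such that for every r > 0 there exist K(r), L(r) > 0 with Φ(u) ≤ K(r) and R(u) ≤ K(r) whenever ‖u‖ ≤ r, and |Φ(u₁) − Φ(u₂)| ≤ L(r)‖u₁ − u₂‖ and |R(u₁) − R(u₂)| ≤ L(r)‖u₁ − u₂‖ whenever ‖u₁‖, ‖u₂‖ ≤ r. For N ∈ ℕ define u_N = Σ_{k=1}^N ⟨u, e_k⟩ e_k, let μ have density proportional to exp(−Φ(u) − R(u)) with respect to μ₀, and let μ_N have density proportional to exp(−Φ(u_N) − R(u_N)). Then d_Hell(μ, μ_N) → 0 as N → ∞. -/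
open MeasureTheory
open scoped RealInnerProductSpace

theorem hell_aux {X : Type*} [MeasurableSpace X] (μ : Measure X) [IsProbabilityMeasure μ]
    (f : X → ℝ) (g : ℕ → X → ℝ) (hf : Measurable f) (hg : ∀ N, Measurable (g N))
    (hf0 : ∀ u, 0 < f u) (hf1 : ∀ u, f u ≤ 1) (hg0 : ∀ N u, 0 < g N u) (hg1 : ∀ N u, g N u ≤ 1)
    (hlim : ∀ u, Filter.Tendsto (fun N => g N u) Filter.atTop (nhds (f u))) :
    Filter.Tendsto (fun N : ℕ => Real.sqrt ((1 / 2) * ∫ u,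
      (Real.sqrt ((∫ v, f v ∂μ)⁻¹ * f u) - Real.sqrt ((∫ v, g N v ∂μ)⁻¹ * g N u)) ^ 2 ∂μ))
      Filter.atTop (nhds 0) := by
  have hZ : Filter.Tendsto (fun N => ∫ v, g N v ∂μ) Filter.atTop (nhds (∫ v, f v ∂μ)) := by
    refine tendsto_integral_of_dominated_convergence (fun _ => (1 : ℝ))
      (fun N => (hg N).aestronglyMeasurable) (integrable_const _) ?_ ?_
    · intro N
      filter_upwards with u
      rw [Real.norm_of_nonneg (hg0 N u).le]
      exact hg1 N u
    · filter_upwards with u using hlim u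
  have hint : Integrable f μ := by
    refine Integrable.mono' (integrable_const (1 : ℝ)) hf.aestronglyMeasurable ?_
    filter_upwards with u
    rw [Real.norm_of_nonneg (hf0 u).le]
    exact hf1 u
  have hpos : 0 < ∫ v, f v ∂μ := by
    rw [integral_pos_iff_support_of_nonneg (fun u => (hf0 u).le) hint]
    have : Function.support f = Set.univ := by
      ext u
      simp [(hf0 u).ne']
    rw [this]
    simp
  have hZi := hZ.inv₀ hpos.ne'
  set Z := ∫ v, f v ∂μ with hZdef
  have hs := (Real.continuous_sqrt.tendsto _).comp hZi
  have hev : ∀ᶠ N in Filter.atTop, Real.sqrt ((∫ v, g N v ∂μ)⁻¹) ≤ Real.sqrt Z⁻¹ + 1 :=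
    (hs.eventually (gt_mem_nhds (lt_add_one _))).mono (fun N h => le_of_lt h)
  have hI : Filter.Tendsto (fun N : ℕ => ∫ u,
      (Real.sqrt (Z⁻¹ * f u) - Real.sqrt ((∫ v, g N v ∂μ)⁻¹ * g N u)) ^ 2 ∂μ)
      Filter.atTop (nhds (∫ _u : X, (0 : ℝ) ∂μ)) := by
    refine tendsto_integral_filter_of_dominated_convergence
      (fun _ => (Real.sqrt Z⁻¹ + 1) ^ 2) ?_ ?_ (integrable_const _) ?_
    · filter_upwards with N
      have := hg N
      exact Measurable.aestronglyMeasurable (by fun_prop)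
    · filter_upwards [hev] with N hN
      filter_upwards with u
      rw [Real.norm_of_nonneg (sq_nonneg _), sq_le_sq, abs_of_nonneg (a := Real.sqrt Z⁻¹ + 1) (by positivity)]
      have hZN : 0 ≤ ∫ v, g N v ∂μ := integral_nonneg (fun v => (hg0 N v).le)
      have h1 : Real.sqrt (Z⁻¹ * f u) ≤ Real.sqrt Z⁻¹ :=
        Real.sqrt_le_sqrt (mul_le_of_le_one_right (by positivity) (hf1 u))
      have h2 : Real.sqrt ((∫ v, g N v ∂μ)⁻¹ * g N u) ≤ Real.sqrt ((∫ v, g N v ∂μ)⁻¹) :=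
        Real.sqrt_le_sqrt (mul_le_of_le_one_right (by positivity) (hg1 N u))
      have h3 := Real.sqrt_nonneg (Z⁻¹ * f u)
      have h4 := Real.sqrt_nonneg ((∫ v, g N v ∂μ)⁻¹ * g N u)
      rw [abs_le]
      constructor <;> linarith
    · filter_upwards with u
      have h := (Real.continuous_sqrt.tendsto _).comp (hZi.mul (hlim u))
      have h' := ((tendsto_const_nhds (x := Real.sqrt (Z⁻¹ * f u))).sub h).pow 2
      simpa using h'
  have h := (Real.continuous_sqrt.tendsto _).comp (hI.const_mul (1 / 2))
  rw [integral_zero, mul_zero, Real.sqrt_zero] at h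
  exact h

theorem cont_aux {X : Type*} [NormedAddCommGroup X] (F : X → ℝ)
    (h : ∀ r > (0 : ℝ), ∃ L > (0 : ℝ), ∀ u₁ u₂ : X, ‖u₁‖ ≤ r → ‖u₂‖ ≤ r →
      |F u₁ - F u₂| ≤ L * ‖u₁ - u₂‖) : Continuous F := by
  rw [continuous_iff_continuousAt]
  intro x
  obtain ⟨L, hL, hF⟩ := h (‖x‖ + 1) (by positivity)
  rw [ContinuousAt, tendsto_iff_dist_tendsto_zero]
  have hev : ∀ᶠ y in nhds x, ‖y‖ < ‖x‖ + 1 :=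
    (continuous_norm.tendsto x).eventually (gt_mem_nhds (lt_add_one _))
  have hz : Filter.Tendsto (fun y => L * ‖y - x‖) (nhds x) (nhds 0) := by
    have : Continuous (fun y => L * ‖y - x‖) := by fun_prop
    simpa using this.tendsto x
  refine squeeze_zero' (Filter.Eventually.of_forall fun _ => dist_nonneg) ?_ hz
  filter_upwards [hev] with y hy
  rw [Real.dist_eq]
  exact hF y x hy.le (by linarith)

/-- Spectral finite-dimensional approximation of the posterior measure: with
`u_N = ∑_{k<N} ⟪u, e_k⟫ e_k`, the Hellinger distance between the posterior `μ`
(density ∝ exp(−Φ(u)−R(u))) and `μ_N` (density ∝ exp(−Φ(u_N)−R(u_N))) tends to zero. -/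
theorem statement_19
    {X : Type*} [NormedAddCommGroup X] [InnerProductSpace ℝ X] [CompleteSpace X]
    [SecondCountableTopology X] [MeasurableSpace X] [BorelSpace X]
    (e : HilbertBasis ℕ ℝ X)
    (μ₀ : Measure X) [IsProbabilityMeasure μ₀]
    (hmoment : Integrable (fun u => ‖u‖ ^ 2) μ₀)
    (hball : ∀ r > (0 : ℝ), 0 < μ₀ {u : X | ‖u‖ ≤ r})
    (Φ R : X → ℝ) (hΦm : Measurable Φ) (hRm : Measurable R)
    (hΦnn : ∀ u, 0 ≤ Φ u) (hRnn : ∀ u, 0 ≤ R u)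
    (hbound : ∀ r > (0 : ℝ), ∃ K > (0 : ℝ), ∀ u : X, ‖u‖ ≤ r → Φ u ≤ K ∧ R u ≤ K)
    (hlip : ∀ r > (0 : ℝ), ∃ L > (0 : ℝ), ∀ u₁ u₂ : X, ‖u₁‖ ≤ r → ‖u₂‖ ≤ r →
      |Φ u₁ - Φ u₂| ≤ L * ‖u₁ - u₂‖ ∧ |R u₁ - R u₂| ≤ L * ‖u₁ - u₂‖) :
    Filter.Tendsto
      (fun N : ℕ =>
        Real.sqrt ((1 / 2) * ∫ u,
          (Real.sqrt ((∫ v, Real.exp (-Φ v - R v) ∂μ₀)⁻¹ * Real.exp (-Φ u - R u)) -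
            Real.sqrt
              ((∫ v, Real.exp
                  (-Φ (∑ k ∈ Finset.range N, ⟪v, e k⟫ • e k) -
                    R (∑ k ∈ Finset.range N, ⟪v, e k⟫ • e k)) ∂μ₀)⁻¹ *
                Real.exp
                  (-Φ (∑ k ∈ Finset.range N, ⟪u, e k⟫ • e k) -
                    R (∑ k ∈ Finset.range N, ⟪u, e k⟫ • e k)))) ^ 2 ∂μ₀))
      Filter.atTop (nhds 0) := by
  have hΦc : Continuous Φ := cont_aux Φ (fun r hr => by
    obtain ⟨L, hL, h⟩ := hlip r hr
    exact ⟨L, hL, fun a b ha hb => (h a b ha hb).1⟩)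
  have hRc : Continuous R := cont_aux R (fun r hr => by
    obtain ⟨L, hL, h⟩ := hlip r hr
    exact ⟨L, hL, fun a b ha hb => (h a b ha hb).2⟩)
  refine hell_aux μ₀ (fun u => Real.exp (-Φ u - R u))
    (fun N u => Real.exp (-Φ (∑ k ∈ Finset.range N, ⟪u, e k⟫ • e k) -
      R (∑ k ∈ Finset.range N, ⟪u, e k⟫ • e k))) ?_ ?_ (fun u => Real.exp_pos _) ?_
      (fun N u => Real.exp_pos _) ?_ ?_
  · fun_prop
  · intro N
    exact Continuous.measurable (by fun_prop)
  · intro u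
    rw [Real.exp_le_one_iff]
    linarith [hΦnn u, hRnn u]
  · intro N u
    rw [Real.exp_le_one_iff]
    linarith [hΦnn (∑ k ∈ Finset.range N, ⟪u, e k⟫ • e k),
      hRnn (∑ k ∈ Finset.range N, ⟪u, e k⟫ • e k)]
  · intro u
    have hu : Filter.Tendsto (fun N => ∑ k ∈ Finset.range N, ⟪u, e k⟫ • e k)
        Filter.atTop (nhds u) := by
      have := (e.hasSum_repr u).tendsto_sum_nat
      simpa only [e.repr_apply_apply, real_inner_comm] using this
    have hc : Continuous (fun u => Real.exp (-Φ u - R u)) := by fun_prop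
    exact (hc.tendsto u).comp hu
end
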